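/- arXiv:1107.1861 — 2 statements merged into one kernel-verified Lean document; each statement's English description precedes it below -/
import Mathlib

section
/- Let Λ be an artin algebra which is torsionless-finite. Then the opposite algebra Λ^op is also torsionless-finite, and the number of isomorphism classes of indecomposable torsionless Λ-modules equals the number of isomorphism classes of indecomposable torsionless Λ^op-modules. -/
open CategoryTheory

universe u

section Defs
variable (Λ : Type u) [Ring Λ]

/-- A module is torsionless if it embeds into a finitely generated free
(equivalently, projective) module. -/
def Torsionless (N : Type u) [AddCommGroup N] [Module Λ N] : Prop :=
  ∃ (n : ℕ) (f : N →ₗ[Λ] (Fin n → Λ)), Function.Injective f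

/-- A module is divisible if it is a quotient of a finitely generated injective module. -/
def Divisible (N : Type u) [AddCommGroup N] [Module Λ N] : Prop :=
  ∃ (Q : ModuleCat.{u} Λ), Module.Finite Λ Q ∧ Module.Injective Λ Q ∧
    ∃ f : ↥Q →ₗ[Λ] N, Function.Surjective f

/-- An indecomposable module: nonzero, and the only idempotent endomorphisms are 0 and 1. -/
def Indec (N : Type u) [AddCommGroup N] [Module Λ N] : Prop :=
  Nontrivial N ∧ ∀ e : Module.End Λ N, e * e = e → e = 0 ∨ e = 1

/-- `N` belongs to `add M`: it is a direct summand of a finite direct sum of copies of `M`. -/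
def InAdd (M : Type u) [AddCommGroup M] [Module Λ M]
    (N : Type u) [AddCommGroup N] [Module Λ N] : Prop :=
  ∃ (n : ℕ) (i : N →ₗ[Λ] (Fin n → M)) (p : (Fin n → M) →ₗ[Λ] N),
    p.comp i = LinearMap.id

/-- `N` is cogenerated by `M`: it embeds into a finite direct sum of copies of `M`. -/
def CogenBy (M : Type u) [AddCommGroup M] [Module Λ M]
    (N : Type u) [AddCommGroup N] [Module Λ N] : Prop :=
  ∃ (n : ℕ) (f : N →ₗ[Λ] (Fin n → M)), Function.Injective f

/-- There are only finitely many isomorphism classes of indecomposable torsionless modules. -/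
def TorsionlessFinite : Prop :=
  ∃ (n : ℕ) (L : Fin n → ModuleCat.{u} Λ),
    ∀ N : ModuleCat.{u} Λ, Module.Finite Λ N → Torsionless Λ N → Indec Λ N →
      ∃ i, Nonempty (N ≃ₗ[Λ] L i)

/-- The algebra is representation-finite. -/
def RepFinite : Prop :=
  ∃ (n : ℕ) (L : Fin n → ModuleCat.{u} Λ),
    ∀ N : ModuleCat.{u} Λ, Module.Finite Λ N → Indec Λ N →
      ∃ i, Nonempty (N ≃ₗ[Λ] L i)

/-- `M` has a projective resolution of length at most `d` by finitely generated projectives. -/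
def ProjDimLE : ℕ → ModuleCat.{u} Λ → Prop
  | 0, M => Module.Projective Λ M
  | (d+1), M => ∃ (P : ModuleCat.{u} Λ) (f : ↥P →ₗ[Λ] ↥M),
      Module.Projective Λ P ∧ Module.Finite Λ P ∧ Function.Surjective f ∧
      ProjDimLE d (ModuleCat.of Λ ↥(LinearMap.ker f))

/-- The global dimension of `Λ` is at most `d`. -/
def GlobalDimLE (d : ℕ) : Prop :=
  ∀ M : ModuleCat.{u} Λ, Module.Finite Λ M → ProjDimLE Λ d M

/-- `M` is a generator-cogenerator: every finitely generated projective and every finitely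
generated injective module lies in `add M`. -/
def IsGenCogen (M : Type u) [AddCommGroup M] [Module Λ M] : Prop :=
  Module.Finite Λ M ∧
  (∀ P : ModuleCat.{u} Λ, Module.Finite Λ P → Module.Projective Λ P → InAdd Λ M ↥P) ∧
  (∀ Q : ModuleCat.{u} Λ, Module.Finite Λ Q → Module.Injective Λ Q → InAdd Λ M ↥Q)

/-- The representation dimension of `Λ` is at most `d`. -/
def RepDimLE (d : ℕ) : Prop :=
  ∃ M : ModuleCat.{u} Λ, IsGenCogen Λ ↥M ∧ GlobalDimLE (Module.End Λ ↥M) d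

end Defs

section Classes
variable (Λ : Type u) [Ring Λ]

/-- `Λ` has exactly `n` isomorphism classes of indecomposable torsionless modules,
represented by the pairwise non-isomorphic family `L`. -/
def TorsionlessClasses (n : ℕ) : Prop :=
  ∃ L : Fin n → ModuleCat.{u} Λ,
    (∀ i, Module.Finite Λ (L i) ∧ Torsionless Λ (L i) ∧ Indec Λ (L i)) ∧
    (∀ i j, i ≠ j → IsEmpty ((L i) ≃ₗ[Λ] (L j))) ∧
    (∀ N : ModuleCat.{u} Λ, Module.Finite Λ N → Torsionless Λ N → Indec Λ N →
      ∃ i, Nonempty (N ≃ₗ[Λ] L i))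

end Classes

section RightMinimal

variable {A : Type*} [Ring A] {P X : Type*} [AddCommGroup P] [Module A P]
  [AddCommGroup X] [Module A X]

/-- A linear map is right minimal if its kernel contains no nonzero direct summand of its
source. -/
def RightMinimal (p : P →ₗ[A] X) : Prop :=
  ∀ e : Module.End A P, e * e = e → p ∘ₗ e = 0 → e = 0

theorem RightMinimal.eq_bot {p : P →ₗ[A] X} (hp : RightMinimal p) {U V : Submodule A P}
    (hUV : IsCompl U V) (hU : U ≤ LinearMap.ker p) : U = ⊥ := by
  have h : U.projection V hUV = 0 := by
    refine hp _ (Submodule.isIdempotentElem_projection hUV) (LinearMap.ext fun x => ?_)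
    exact hU (Submodule.projection_apply_mem hUV x)
  rw [← Submodule.range_projection hUV, h, LinearMap.range_zero]

theorem LinearMap.comp_pow_eq_pow_comp {p : P →ₗ[A] X} {g : Module.End A P}
    {h : Module.End A X} (hgh : p ∘ₗ g = h ∘ₗ p) (N : ℕ) :
    p ∘ₗ (g ^ N) = (h ^ N) ∘ₗ p := by
  induction N with
  | zero => rfl
  | succ N ih =>
    rw [pow_succ, pow_succ, Module.End.mul_eq_comp, Module.End.mul_eq_comp,
      ← LinearMap.comp_assoc, ih, LinearMap.comp_assoc, hgh, LinearMap.comp_assoc]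

/-- An endomorphism of the source of a right minimal map that induces an injective
endomorphism of the target is injective. -/
theorem RightMinimal.injective_of_injective [IsArtinian A P] [IsNoetherian A P]
    {p : P →ₗ[A] X} (hp : RightMinimal p) {g : Module.End A P} {h : Module.End A X}
    (hgh : p ∘ₗ g = h ∘ₗ p) (hh : Function.Injective h) : Function.Injective g := by
  obtain ⟨N, hN, hN0⟩ := (g.eventually_isCompl_ker_pow_range_pow.and
    (Filter.eventually_gt_atTop 0)).exists
  have hker : LinearMap.ker (g ^ N) = ⊥ := by
    refine hp.eq_bot hN fun x hx => ?_
    have h1 : (h ^ N) (p x) = 0 := by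
      rw [← LinearMap.comp_apply, ← LinearMap.comp_pow_eq_pow_comp hgh, LinearMap.comp_apply,
        LinearMap.mem_ker.mp hx, map_zero]
    have h2 : Function.Injective (h ^ N) := by
      rw [Module.End.coe_pow]; exact hh.iterate N
    exact h2 (h1.trans (map_zero _).symm)
  have hinj := LinearMap.ker_eq_bot.mp hker
  rw [Module.End.coe_pow] at hinj
  obtain ⟨m, rfl⟩ := Nat.exists_eq_succ_of_ne_zero hN0.ne'
  rw [Function.iterate_succ] at hinj
  exact hinj.of_comp

/-- An endomorphism of the source of a right minimal map that induces a nilpotent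
endomorphism of the target is nilpotent. -/
theorem RightMinimal.isNilpotent [IsArtinian A P] [IsNoetherian A P]
    {p : P →ₗ[A] X} (hp : RightMinimal p) {g : Module.End A P} {h : Module.End A X}
    (hgh : p ∘ₗ g = h ∘ₗ p) (hh : IsNilpotent h) : IsNilpotent g := by
  obtain ⟨m, hm⟩ := hh
  obtain ⟨N, hN, hmN⟩ := (g.eventually_isCompl_ker_pow_range_pow.and
    (Filter.eventually_ge_atTop m)).exists
  refine ⟨N, LinearMap.range_eq_bot.mp (hp.eq_bot hN.symm ?_)⟩
  rintro _ ⟨x, rfl⟩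
  have := LinearMap.congr_fun (LinearMap.comp_pow_eq_pow_comp hgh N) x
  rw [pow_eq_zero_of_le hmN hm] at this
  exact this

/-- Fitting's lemma for indecomposable modules of finite length. -/
theorem Indec.isNilpotent_or_injective {A X : Type u} [Ring A] [AddCommGroup X] [Module A X]
    [IsArtinian A X] [IsNoetherian A X] (hX : Indec A X)
    (h : Module.End A X) : IsNilpotent h ∨ Function.Injective h := by
  obtain ⟨N, hN, hN0⟩ := (h.eventually_isCompl_ker_pow_range_pow.and
    (Filter.eventually_gt_atTop 0)).exists
  rcases hX.2 _ (Submodule.isIdempotentElem_projection hN) with h0 | h1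
  · right
    have hker : LinearMap.ker (h ^ N) = ⊥ := by
      rw [← Submodule.range_projection hN, h0, LinearMap.range_zero]
    have hinj := LinearMap.ker_eq_bot.mp hker
    rw [Module.End.coe_pow] at hinj
    obtain ⟨m, rfl⟩ := Nat.exists_eq_succ_of_ne_zero hN0.ne'
    rw [Function.iterate_succ] at hinj
    exact hinj.of_comp
  · left
    refine ⟨N, LinearMap.ker_eq_top.mp ?_⟩
    rw [← Submodule.range_projection hN, h1]
    exact LinearMap.range_id

/-- Two right minimal surjections from projective modules of finite length onto isomorphic
modules are isomorphic. -/
theorem RightMinimal.exists_equiv {P' X' : Type*} [AddCommGroup P'] [Module A P']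
    [AddCommGroup X'] [Module A X'] [Module.Projective A P] [Module.Projective A P']
    [IsArtinian A P] [IsNoetherian A P] [IsArtinian A P'] [IsNoetherian A P']
    {p : P →ₗ[A] X} {p' : P' →ₗ[A] X'} (hp : RightMinimal p) (hp' : RightMinimal p')
    (hs : Function.Surjective p) (hs' : Function.Surjective p') (a : X ≃ₗ[A] X') :
    ∃ f : P ≃ₗ[A] P', ∀ x, p' (f x) = a (p x) := by
  obtain ⟨f, hf⟩ := Module.projective_lifting_property p' (a.toLinearMap ∘ₗ p) hs'
  obtain ⟨g, hg⟩ := Module.projective_lifting_property p (a.symm.toLinearMap ∘ₗ p') hs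
  have hf' : ∀ x, p' (f x) = a (p x) := LinearMap.congr_fun hf
  have hg' : ∀ x, p (g x) = a.symm (p' x) := LinearMap.congr_fun hg
  have h1 : Function.Injective (g ∘ₗ f) :=
    hp.injective_of_injective (h := LinearMap.id)
      (LinearMap.ext fun x => by simp [hg', hf']) Function.injective_id
  have h2 : Function.Injective (f ∘ₗ g) :=
    hp'.injective_of_injective (h := LinearMap.id)
      (LinearMap.ext fun x => by simp [hg', hf']) Function.injective_id
  have h3 : Function.Surjective (f ∘ₗ g) := IsArtinian.surjective_of_injective_endomorphism _ h2
  rw [LinearMap.coe_comp] at h1 h3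
  exact ⟨LinearEquiv.ofBijective f ⟨h1.of_comp, h3.of_comp⟩, LinearMap.congr_fun hf⟩

/-- Every finitely generated module over an artinian ring is the image of a right minimal map
from a finitely generated projective module. -/
theorem exists_rightMinimal_surjective (A X : Type u) [Ring A] [IsArtinianRing A]
    [AddCommGroup X] [Module A X] [Module.Finite A X] :
    ∃ (P : ModuleCat.{u} A) (p : ↥P →ₗ[A] X), Module.Finite A P ∧ Module.Projective A P ∧
      Function.Surjective p ∧ RightMinimal p := by
  obtain ⟨n, p, hp⟩ := Module.Finite.exists_fin' A X
  obtain ⟨W, ⟨hW, hWp⟩, hmin⟩ := IsArtinian.set_has_minimal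
    {W : Submodule A (Fin n → A) | Module.Projective A W ∧
      Function.Surjective (p ∘ₗ W.subtype)} ⟨⊤,
        Module.Projective.of_equiv (Submodule.topEquiv (R := A) (M := Fin n → A)).symm,
        fun x => (hp x).imp' (fun y => ⟨y, trivial⟩) fun _ h => h⟩
  refine ⟨ModuleCat.of A W, p ∘ₗ W.subtype, inferInstanceAs (Module.Finite A W), hW, hWp,
    fun (e : Module.End A W) he hpe => ?_⟩
  have he' : ∀ x, e (e x) = e x := LinearMap.congr_fun he
  have hpe' : ∀ x : W, p (e x) = 0 := LinearMap.congr_fun hpe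
  let c : Module.End A W := 1 - e
  let U : Submodule A (Fin n → A) := (LinearMap.range c).map W.subtype
  have hUW : U ≤ W := Submodule.map_subtype_le _ _
  have hU : ¬ U < W := by
    refine hmin U ⟨?_, ?_⟩
    · have : Module.Projective A (LinearMap.range c) := by
        refine Module.Projective.of_split (LinearMap.range c).subtype c.rangeRestrict ?_
        ext ⟨_, x, rfl⟩ : 1
        apply Subtype.ext
        simp [c, he']
      exact Module.Projective.of_equiv
        (Submodule.equivMapOfInjective W.subtype W.subtype_injective (LinearMap.range c))
    · intro x
      obtain ⟨w, hw⟩ := hWp x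
      refine ⟨⟨c w, ⟨c w, ⟨w, rfl⟩, rfl⟩⟩, ?_⟩
      have : p w = x := hw
      simp [c, hpe', this]
  have hWU : W ≤ U := by
    by_contra h
    exact hU (lt_of_le_of_ne hUW fun h' => h h'.ge)
  ext1 w
  obtain ⟨_, ⟨v, rfl⟩, hv⟩ := hWU w.2
  have hv' : c v = w := Subtype.ext hv
  rw [← hv']
  simp [c, he']

end RightMinimal

section Duality

set_option linter.unusedSectionVars false

variable {A B D : Type u} [Ring A] [Ring B] [AddCommGroup D] [Module A D] [Module B D]
  [SMulCommClass A B D] [SMulCommClass B A D]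

/-- The element `d` freely generates the bimodule `D` from both sides. -/
def IsBiregular (A B : Type u) {D : Type u} [Ring A] [Ring B] [AddCommGroup D] [Module A D]
    [Module B D] (d : D) : Prop :=
  Function.Bijective (LinearMap.toSpanSingleton A D d) ∧
    Function.Bijective (LinearMap.toSpanSingleton B D d)

theorem IsBiregular.symm {d : D} (h : IsBiregular A B d) : IsBiregular B A d := ⟨h.2, h.1⟩

section Pairing

variable {P Q P' Q' : Type u} [AddCommGroup P'] [Module A P'] [AddCommGroup Q'] [Module B Q']
  [AddCommGroup P] [Module A P] [AddCommGroup Q] [Module B Q]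

/-- A perfect pairing between finitely generated projective modules over `A` and over `B`,
with values in the bimodule `D`. -/
structure IsDualPair (β : P →ₗ[A] Q →ₗ[B] D) : Prop where
  finite_left : Module.Finite A P
  projective_left : Module.Projective A P
  finite_right : Module.Finite B Q
  projective_right : Module.Projective B Q
  bijective_left : Function.Bijective β
  bijective_right : Function.Bijective β.flip


theorem IsDualPair.flip {β : P →ₗ[A] Q →ₗ[B] D} (h : IsDualPair β) : IsDualPair β.flip :=
  ⟨h.finite_right, h.projective_right, h.finite_left, h.projective_left, h.bijective_right,
    h.bijective_left⟩

theorem IsDualPair.eq_zero_left {β : P →ₗ[A] Q →ₗ[B] D} (h : IsDualPair β) {x : P}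
    (hx : ∀ y, β x y = 0) : x = 0 :=
  h.bijective_left.1 ((LinearMap.ext hx).trans (map_zero β).symm)

theorem IsDualPair.eq_zero_right {β : P →ₗ[A] Q →ₗ[B] D} (h : IsDualPair β) {y : Q}
    (hy : ∀ x, β x y = 0) : y = 0 :=
  h.flip.eq_zero_left hy

theorem IsDualPair.exists_transpose {β : P →ₗ[A] Q →ₗ[B] D} {β' : P' →ₗ[A] Q' →ₗ[B] D}
    (h : IsDualPair β) (f : P →ₗ[A] P') :
    ∃ g : Q' →ₗ[B] Q, ∀ x y, β x (g y) = β' (f x) y := by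
  let E := LinearEquiv.ofBijective β.flip h.bijective_right
  let F : Q' →ₗ[B] P →ₗ[A] D := (β' ∘ₗ f).flip
  refine ⟨E.symm.toLinearMap ∘ₗ F, fun x y => ?_⟩
  exact LinearMap.congr_fun (E.apply_symm_apply (F y)) x

/-- Isomorphic modules have isomorphic duals. -/
theorem IsDualPair.exists_transpose_equiv {β : P →ₗ[A] Q →ₗ[B] D} {β' : P' →ₗ[A] Q' →ₗ[B] D}
    (h : IsDualPair β) (h' : IsDualPair β') (f : P ≃ₗ[A] P') :
    ∃ g : Q' ≃ₗ[B] Q, ∀ x y, β x (g y) = β' (f x) y := by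
  obtain ⟨g, hg⟩ := h.exists_transpose (β' := β') f.toLinearMap
  obtain ⟨g', hg'⟩ := h'.exists_transpose (β' := β) f.symm.toLinearMap
  simp only [LinearEquiv.coe_coe] at hg hg'
  refine ⟨LinearEquiv.ofLinearMap g g' (LinearMap.ext fun y => ?_) (LinearMap.ext fun y => ?_), hg⟩
  · refine sub_eq_zero.mp (h.eq_zero_right fun x => ?_)
    simp [hg, hg']
  · refine sub_eq_zero.mp (h'.eq_zero_right fun x => ?_)
    simp [hg, hg']

end Pairing

/-- Every finitely generated projective module is part of a dual pair. -/
theorem IsBiregular.exists_isDualPair {d : D} (hd : IsBiregular A B d) (P : Type u)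
    [AddCommGroup P] [Module A P] [Module.Finite A P] [Module.Projective A P] :
    ∃ (Q : ModuleCat.{u} B) (β : P →ₗ[A] ↥Q →ₗ[B] D), IsDualPair β := by
  obtain ⟨n, s, i, -, -, hsi⟩ := Module.Finite.exists_comp_eq_id_of_projective A P
  have hsi' : ∀ x, s (i x) = x := LinearMap.congr_fun hsi
  let EA := LinearEquiv.ofBijective _ hd.1
  let EB := LinearEquiv.ofBijective _ hd.2
  have hEA : ∀ a : A, EA a = a • d := fun _ => rfl
  have hEB : ∀ b : B, EB b = b • d := fun _ => rfl
  have hEAsymm : ∀ z : D, EA.symm z • d = z := fun z => EA.apply_symm_apply z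
  have hEBsymm : ∀ z : D, EB.symm z • d = z := fun z => EB.apply_symm_apply z
  let β : P →ₗ[A] (P →ₗ[A] D) →ₗ[B] D := (LinearMap.id : (P →ₗ[A] D) →ₗ[B] P →ₗ[A] D).flip
  let b : Fin n → P := fun j => s fun k => if j = k then 1 else 0
  have hb : ∀ x, x = ∑ j, i x j • b j := fun x => by
    conv_lhs => rw [← hsi' x, LinearMap.pi_apply_eq_sum_univ s (i x)]
  let φ : Fin n → P →ₗ[A] D := fun j => LinearMap.toSpanSingleton A D d ∘ₗ LinearMap.proj j ∘ₗ i
  have hφ : ∀ j x, φ j x = i x j • d := fun _ _ => rfl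
  have hexp : ∀ q : P →ₗ[A] D, q = ∑ j, EB.symm (q (b j)) • φ j := fun q => by
    ext x
    conv_lhs => rw [hb x]
    rw [map_sum, LinearMap.sum_apply]
    refine Finset.sum_congr rfl fun j _ => ?_
    rw [map_smul, LinearMap.smul_apply, hφ, smul_comm, hEBsymm]
  let S : (Fin n → B) →ₗ[B] P →ₗ[A] D := Fintype.linearCombination B φ
  let I : (P →ₗ[A] D) →ₗ[B] Fin n → B := LinearMap.pi fun j => EB.symm.toLinearMap ∘ₗ β (b j)
  have hSI : S ∘ₗ I = LinearMap.id := LinearMap.ext fun q => (hexp q).symm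
  refine ⟨ModuleCat.of B (P →ₗ[A] D), β, ‹_›, ‹_›, ?_, ?_, ⟨?_, ?_⟩, Function.bijective_id⟩
  · exact Module.Finite.of_surjective S fun q => ⟨I q, LinearMap.congr_fun hSI q⟩
  · exact Module.Projective.of_split I S hSI
  · refine (injective_iff_map_eq_zero β).mpr fun x hx => ?_
    have hix : i x = 0 := funext fun j => EA.injective <| by
      have : β x (φ j) = 0 := LinearMap.congr_fun hx (φ j)
      rw [Pi.zero_apply, map_zero, hEA]
      exact this
    rw [← hsi' x, hix, map_zero]
  · intro (F : (P →ₗ[A] D) →ₗ[B] D)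
    refine ⟨∑ j, EA.symm (F (φ j)) • b j, LinearMap.ext fun (q : P →ₗ[A] D) => ?_⟩
    change q _ = F q
    conv_rhs => rw [hexp q]
    rw [map_sum, map_sum]
    refine Finset.sum_congr rfl fun j _ => ?_
    rw [map_smul, map_smul]
    conv_lhs => rw [← hEBsymm (q (b j)), smul_comm, hEAsymm]

/-- Over an artinian ring, a finitely generated module whose points are separated by
functionals is torsionless. -/
theorem IsBiregular.torsionless [IsArtinianRing A] {d : D} (hd : IsBiregular A B d) {X : Type u}
    [AddCommGroup X] [Module A X] [Module.Finite A X]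
    (h : ∀ x : X, (∀ f : X →ₗ[A] D, f x = 0) → x = 0) : Torsionless A X := by
  obtain ⟨K, ⟨n, f, rfl⟩, hmin⟩ := IsArtinian.set_has_minimal
    {K : Submodule A X | ∃ (n : ℕ) (f : X →ₗ[A] Fin n → A), LinearMap.ker f = K}
    ⟨_, 0, 0, rfl⟩
  refine ⟨n, f, (injective_iff_map_eq_zero f).mpr fun x hx => h x fun φ => ?_⟩
  let E := LinearEquiv.ofBijective _ hd.1
  let ψ : X →ₗ[A] A := E.symm.toLinearMap ∘ₗ φ
  let g : X →ₗ[A] Fin (n + 1) → A :=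
    LinearMap.pi (Fin.cons ψ fun j => LinearMap.proj j ∘ₗ f)
  have hg0 : ∀ y, g y 0 = ψ y := fun _ => rfl
  have hgs : ∀ y j, g y (Fin.succ j) = f y j := fun _ _ => rfl
  have hle : LinearMap.ker g ≤ LinearMap.ker f := fun y hy => funext fun j => by
    rw [← hgs, LinearMap.mem_ker.mp hy]; rfl
  have hx' : x ∈ LinearMap.ker g := by
    by_contra hx'
    exact hmin _ ⟨_, g, rfl⟩ (lt_of_le_of_ne hle fun h' => hx' (h' ▸ hx))
  have h0 : ψ x = 0 := by rw [← hg0, LinearMap.mem_ker.mp hx']; rfl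
  exact E.symm.injective (h0.trans (map_zero _).symm)

theorem IsBiregular.eq_zero_of_torsionless {d : D} (hd : IsBiregular A B d) {X : Type u}
    [AddCommGroup X] [Module A X] (hX : Torsionless A X) {x : X}
    (h : ∀ f : X →ₗ[A] D, f x = 0) : x = 0 := by
  obtain ⟨n, f, hf⟩ := hX
  refine (injective_iff_map_eq_zero f).mp hf x (funext fun j => hd.1.1 ?_)
  exact (h (LinearMap.toSpanSingleton A D d ∘ₗ LinearMap.proj j ∘ₗ f)).trans
    (map_zero (LinearMap.toSpanSingleton A D d)).symm

section Covers

variable {P Q X Y P' Q' X' Y' : Type u}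
  [AddCommGroup P'] [Module A P'] [AddCommGroup Q'] [Module B Q']
  [AddCommGroup X'] [Module A X'] [AddCommGroup Y'] [Module B Y']
  [AddCommGroup P] [Module A P] [AddCommGroup Q] [Module B Q]
  [AddCommGroup X] [Module A X] [AddCommGroup Y] [Module B Y]

/-- Two minimal projective covers whose sources are dual to each other and whose kernels are
annihilators of each other. -/
structure DualCovers (β : P →ₗ[A] Q →ₗ[B] D) (p : P →ₗ[A] X) (q : Q →ₗ[B] Y) : Prop where
  isDualPair : IsDualPair β
  surjective_left : Function.Surjective p
  surjective_right : Function.Surjective q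
  minimal_left : RightMinimal p
  minimal_right : RightMinimal q
  ker_left : ∀ x, p x = 0 ↔ ∀ y, q y = 0 → β x y = 0
  ker_right : ∀ y, q y = 0 ↔ ∀ x, p x = 0 → β x y = 0

variable {β : P →ₗ[A] Q →ₗ[B] D} {p : P →ₗ[A] X} {q : Q →ₗ[B] Y}
  {β' : P' →ₗ[A] Q' →ₗ[B] D} {p' : P' →ₗ[A] X'} {q' : Q' →ₗ[B] Y'}

theorem DualCovers.flip (h : DualCovers β p q) : DualCovers β.flip q p :=
  ⟨h.isDualPair.flip, h.surjective_right, h.surjective_left, h.minimal_right, h.minimal_left,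
    h.ker_right, h.ker_left⟩

/-- A linear map out of the source of a surjection that vanishes on its kernel factors. -/
theorem LinearMap.exists_factor_of_surjective {M : Type*} [AddCommGroup M] [Module A M]
    {p : P →ₗ[A] X} (hp : Function.Surjective p) (g : P →ₗ[A] M)
    (h : ∀ x, p x = 0 → g x = 0) : ∃ s : X →ₗ[A] M, ∀ x, s (p x) = g x := by
  refine ⟨(LinearMap.ker p).liftQ g (fun x hx => h x hx) ∘ₗ
    (p.quotKerEquivOfSurjective hp).symm.toLinearMap, fun x => ?_⟩
  have : (p.quotKerEquivOfSurjective hp).symm (p x) = Submodule.Quotient.mk x := by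
    rw [LinearEquiv.symm_apply_eq]; rfl
  rw [LinearMap.comp_apply, LinearEquiv.coe_coe, this]
  rfl

theorem DualCovers.torsionless_right [IsArtinianRing B] {d : D} (hd : IsBiregular A B d)
    [Module.Finite B Y] (h : DualCovers β p q) : Torsionless B Y := by
  refine hd.symm.torsionless fun y hy => ?_
  obtain ⟨y, rfl⟩ := h.surjective_right y
  refine (h.ker_right y).mpr fun x hx => ?_
  obtain ⟨s, hs⟩ := LinearMap.exists_factor_of_surjective h.surjective_right (β x)
    ((h.ker_left x).mp hx)
  rw [← hs, hy]

theorem DualCovers.nontrivial_right (h : DualCovers β p q) [Nontrivial X] : Nontrivial Y := by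
  by_contra hY
  rw [not_nontrivial_iff_subsingleton] at hY
  have h1 : (1 : Module.End B Q) = 0 :=
    h.minimal_right 1 (one_mul 1) (LinearMap.ext fun _ => Subsingleton.elim _ _)
  obtain ⟨x, hx⟩ := exists_ne (0 : X)
  obtain ⟨x, rfl⟩ := h.surjective_left x
  apply hx
  rw [h.isDualPair.eq_zero_left (x := x), map_zero]
  intro y
  have : y = 0 := LinearMap.congr_fun h1 y
  rw [this, map_zero]

theorem DualCovers.not_projective_right (h : DualCovers β p q) [Nontrivial X] :
    ¬ Module.Projective B Y := by
  intro hY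
  obtain ⟨s, hs⟩ := Module.projective_lifting_property q LinearMap.id h.surjective_right
  have hs' : ∀ y, q (s y) = y := LinearMap.congr_fun hs
  have h0 : (1 : Module.End B Q) - s ∘ₗ q = 0 := by
    refine h.minimal_right _ (LinearMap.ext fun y => ?_) (LinearMap.ext fun y => ?_) <;>
      simp [hs']
  have hinj : ∀ y, q y = 0 → y = 0 := fun y hy => by
    have := LinearMap.congr_fun h0 y
    simpa [hy] using this
  have hp0 : p = 0 := LinearMap.ext fun x => (h.ker_left x).mpr fun y hy => by
    rw [hinj y hy, map_zero]
  obtain ⟨x, hx⟩ := exists_ne (0 : X)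
  obtain ⟨x, rfl⟩ := h.surjective_left x
  exact hx (LinearMap.congr_fun hp0 x)

/-- The modules covered by dual covers determine each other up to isomorphism. -/
theorem DualCovers.nonempty_equiv_right [IsArtinianRing A]
    (h : DualCovers β p q) (h' : DualCovers β' p' q') (a : X ≃ₗ[A] X') :
    Nonempty (Y ≃ₗ[B] Y') := by
  have := h.isDualPair.finite_left
  have := h.isDualPair.projective_left
  have := h'.isDualPair.finite_left
  have := h'.isDualPair.projective_left
  obtain ⟨f, hf⟩ := h.minimal_left.exists_equiv h'.minimal_left h.surjective_left
    h'.surjective_left a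
  obtain ⟨g, hg⟩ := h.isDualPair.exists_transpose_equiv h'.isDualPair f
  have hpf : ∀ x, p' (f x) = 0 ↔ p x = 0 := fun x => by
    rw [hf]; exact a.map_eq_zero_iff
  have hker : ∀ y, q (g y) = 0 ↔ q' y = 0 := fun y => by
    rw [h.ker_right, h'.ker_right, f.surjective.forall]
    simp only [hpf, hg]
  let t : Q' →ₗ[B] Y := q ∘ₗ g.toLinearMap
  have ht : Function.Surjective t := h.surjective_right.comp g.surjective
  have hkt : LinearMap.ker t = LinearMap.ker q' := Submodule.ext hker
  exact ⟨(t.quotKerEquivOfSurjective ht).symm ≪≫ₗ Submodule.quotEquivOfEq _ _ hkt ≪≫ₗ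
    q'.quotKerEquivOfSurjective h'.surjective_right⟩

theorem DualCovers.indec_right [IsArtinianRing A] [IsArtinianRing B] [Module.Finite A X]
    [Module.Finite B Y] (h : DualCovers β p q) (hX : Indec A X) : Indec B Y := by
  have := h.isDualPair.finite_left
  have := h.isDualPair.finite_right
  have := h.isDualPair.projective_right
  have := hX.1
  refine ⟨h.nontrivial_right, fun e he => ?_⟩
  obtain ⟨f, hf⟩ := Module.projective_lifting_property q (e ∘ₗ q) h.surjective_right
  have hf' : ∀ y, q (f y) = e (q y) := LinearMap.congr_fun hf
  obtain ⟨g, hg⟩ := h.isDualPair.flip.exists_transpose (β' := β.flip) f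
  replace hg : ∀ x y, β (g x) y = β x (f y) := fun x y => hg y x
  obtain ⟨s, hs⟩ := LinearMap.exists_factor_of_surjective h.surjective_left (p ∘ₗ g)
    fun x hx => (h.ker_left _).mpr fun y hy => by
      rw [hg]
      exact (h.ker_left x).mp hx _ (by rw [hf', hy, map_zero])
  have hsg : p ∘ₗ g = s ∘ₗ p := LinearMap.ext fun x => (hs x).symm
  have hgN : ∀ (N : ℕ) x y, β ((g ^ N) x) y = β x ((f ^ N) y) := fun N => by
    induction N with
    | zero => exact fun _ _ => rfl
    | succ N ih =>
      intro x y
      rw [pow_succ, pow_succ', Module.End.mul_apply, Module.End.mul_apply, ih, hg]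
  rcases hX.isNilpotent_or_injective s with hnil | hinj
  · left
    obtain ⟨N, hN⟩ := h.minimal_left.isNilpotent hsg hnil
    have hfN : f ^ (N + 1) = 0 := LinearMap.ext fun y => h.isDualPair.eq_zero_right fun x => by
      rw [← hgN, pow_succ, hN, zero_mul, LinearMap.zero_apply, map_zero, LinearMap.zero_apply]
    have heN : e ^ (N + 1) = e := IsIdempotentElem.pow_succ_eq N he
    rw [← heN]
    ext y
    obtain ⟨y, rfl⟩ := h.surjective_right y
    have := LinearMap.congr_fun (LinearMap.comp_pow_eq_pow_comp hf (N + 1)) y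
    rw [hfN] at this
    simpa using this.symm
  · right
    have hgs : Function.Surjective g :=
      IsArtinian.surjective_of_injective_endomorphism g
        (h.minimal_left.injective_of_injective hsg hinj)
    have hfs : Function.Surjective f := by
      refine IsArtinian.surjective_of_injective_endomorphism f
        ((injective_iff_map_eq_zero f).mpr fun y hy => h.isDualPair.eq_zero_right fun x => ?_)
      obtain ⟨x, rfl⟩ := hgs x
      rw [hg, hy, map_zero]
    ext y
    obtain ⟨y, rfl⟩ := h.surjective_right y
    obtain ⟨y, rfl⟩ := hfs y
    rw [hf', ← Module.End.mul_apply, he, Module.End.one_apply]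

/-- A nonprojective indecomposable torsionless module has a dual cover. -/
theorem IsBiregular.exists_dualCovers [IsArtinianRing A] {d : D} (hd : IsBiregular A B d)
    (X : Type u) [AddCommGroup X] [Module A X] [Module.Finite A X] (hX : Torsionless A X)
    (hi : Indec A X) (hnp : ¬ Module.Projective A X) :
    ∃ (P : ModuleCat.{u} A) (Q Y : ModuleCat.{u} B) (β : ↥P →ₗ[A] ↥Q →ₗ[B] D)
      (p : ↥P →ₗ[A] X) (q : ↥Q →ₗ[B] ↥Y), Module.Finite B Y ∧ DualCovers β p q := by
  obtain ⟨P, p, _, _, hp, hmin⟩ := exists_rightMinimal_surjective A X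
  obtain ⟨Q, β, hβ⟩ := hd.exists_isDualPair P
  have := hβ.finite_right
  let L : Submodule B Q := ⨅ x : LinearMap.ker p, LinearMap.ker (β x)
  have hL : ∀ y, L.mkQ y = 0 ↔ ∀ x, p x = 0 → β x y = 0 := fun y => by
    simp [L, Submodule.mem_iInf]
  refine ⟨P, Q, ModuleCat.of B (Q ⧸ L), β, p, L.mkQ, inferInstanceAs (Module.Finite B (Q ⧸ L)),
    hβ, hp, L.mkQ_surjective, hmin, fun e he hqe => ?_, fun x => ?_, hL⟩
  · have he' : ∀ y, e (e y) = e y := LinearMap.congr_fun he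
    obtain ⟨g, hg⟩ := hβ.flip.exists_transpose (β' := β.flip) e
    replace hg : ∀ x y, β (g x) y = β x (e y) := fun x y => hg y x
    have hgg : ∀ x, g (g x) = g x := fun x => sub_eq_zero.mp (hβ.eq_zero_left fun y => by
      simp [hg, he'])
    obtain ⟨s, hs⟩ := LinearMap.exists_factor_of_surjective hp g fun x hx =>
      hβ.eq_zero_left fun y => by
        rw [hg]
        exact (hL (e y)).mp (LinearMap.congr_fun hqe y) x hx
    have hsps : ∀ z, s (p (s z)) = s z := fun z => by
      obtain ⟨x, rfl⟩ := hp z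
      rw [hs, hs, hgg]
    rcases hi.2 (p ∘ₗ s) (LinearMap.ext fun z => congrArg p (hsps z)) with h0 | h1
    · have hs0 : ∀ z, s z = 0 := fun z => by
        rw [← hsps z]
        have : p (s z) = 0 := LinearMap.congr_fun h0 z
        rw [this, map_zero]
      exact LinearMap.ext fun y => hβ.eq_zero_right fun x => by
        rw [← hg, ← hs, hs0, map_zero, LinearMap.zero_apply]
    · exact absurd (Module.Projective.of_split s p h1) hnp
  · refine ⟨fun hx y hy => (hL y).mp hy x hx, fun hx => ?_⟩
    refine hd.eq_zero_of_torsionless hX fun f => ?_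
    obtain ⟨y, hy⟩ := hβ.bijective_right.2 (f ∘ₗ p)
    have hy' : ∀ x, β x y = f (p x) := LinearMap.congr_fun hy
    rw [← hy']
    exact hx y ((hL y).mpr fun z hz => by rw [hy', hz, map_zero])

end Covers

section Correspondence

variable (D) in
/-- Indecomposable torsionless modules correspond to each other if they are dual projective
modules or have dual covers. -/
def Corresponds (X : ModuleCat.{u} A) (Y : ModuleCat.{u} B) : Prop :=
  (∃ β : ↥X →ₗ[A] ↥Y →ₗ[B] D, IsDualPair β) ∨
    ∃ (P : ModuleCat.{u} A) (Q : ModuleCat.{u} B) (β : ↥P →ₗ[A] ↥Q →ₗ[B] D)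
      (p : ↥P →ₗ[A] ↥X) (q : ↥Q →ₗ[B] ↥Y), DualCovers β p q

/-- Finitely generated indecomposable torsionless modules. -/
def IsTorsionlessIndec (X : ModuleCat.{u} A) : Prop :=
  Module.Finite A X ∧ Torsionless A X ∧ Indec A X

theorem Corresponds.symm {X : ModuleCat.{u} A} {Y : ModuleCat.{u} B} (h : Corresponds D X Y) :
    Corresponds D Y X := by
  rcases h with ⟨β, h⟩ | ⟨P, Q, β, p, q, h⟩
  · exact .inl ⟨_, h.flip⟩
  · exact .inr ⟨_, _, _, _, _, h.flip⟩

theorem Corresponds.nonempty_equiv_right [IsArtinianRing A] {X X' : ModuleCat.{u} A}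
    {Y Y' : ModuleCat.{u} B} (hX : Nontrivial X) (hY : Nontrivial Y) (hY' : Nontrivial Y')
    (h : Corresponds D X Y) (h' : Corresponds D X' Y') (a : X ≃ₗ[A] X') :
    Nonempty (Y ≃ₗ[B] Y') := by
  have hX' : Nontrivial X' := a.symm.toEquiv.nontrivial
  rcases h with ⟨β, h⟩ | ⟨P, Q, β, p, q, h⟩ <;> rcases h' with ⟨β', h'⟩ | ⟨P', Q', β', p', q', h'⟩
  · obtain ⟨g, -⟩ := h.exists_transpose_equiv h' a
    exact ⟨g.symm⟩
  · have := h.projective_left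
    exact absurd (Module.Projective.of_equiv a) h'.flip.not_projective_right
  · have := h'.projective_left
    exact absurd (Module.Projective.of_equiv a.symm) h.flip.not_projective_right
  · exact h.nonempty_equiv_right h' a

theorem IsBiregular.exists_corresponds [IsArtinianRing A] [IsArtinianRing B] {d : D}
    (hd : IsBiregular A B d) {X : ModuleCat.{u} A} (hX : IsTorsionlessIndec X) :
    ∃ Y : ModuleCat.{u} B, IsTorsionlessIndec Y ∧ Corresponds D X Y := by
  obtain ⟨_, ht, hi⟩ := hX
  by_cases hp : Module.Projective A X
  · obtain ⟨Y, β, h⟩ := hd.exists_isDualPair X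
    have := h.finite_right
    refine ⟨Y, ⟨h.finite_right, ?_, ?_, fun e he => ?_⟩, .inl ⟨β, h⟩⟩
    · exact hd.symm.torsionless fun y hy => h.eq_zero_right fun x => hy (β x)
    · have := hi.1
      by_contra hY
      rw [not_nontrivial_iff_subsingleton] at hY
      obtain ⟨x, hx⟩ := exists_ne (0 : X)
      exact hx (h.eq_zero_left fun y => by rw [Subsingleton.elim y 0, map_zero])
    · have he' : ∀ y, e (e y) = e y := LinearMap.congr_fun he
      obtain ⟨g, hg⟩ := h.flip.exists_transpose (β' := β.flip) e
      replace hg : ∀ x y, β (g x) y = β x (e y) := fun x y => hg y x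
      rcases hi.2 g (LinearMap.ext fun x => sub_eq_zero.mp (h.eq_zero_left fun y => by
        simp [hg, he'])) with rfl | rfl
      · left
        exact LinearMap.ext fun y => h.eq_zero_right fun x => by
          rw [← hg, LinearMap.zero_apply, map_zero, LinearMap.zero_apply]
      · right
        exact LinearMap.ext fun y => sub_eq_zero.mp (h.eq_zero_right fun x => by
          rw [map_sub, ← hg, Module.End.one_apply, Module.End.one_apply, sub_self])
  · obtain ⟨P, Q, Y, β, p, q, _, h⟩ := hd.exists_dualCovers X ht hi hp
    exact ⟨Y, ⟨‹_›, h.torsionless_right hd, h.indec_right hi⟩, .inr ⟨P, Q, β, p, q, h⟩⟩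

theorem TorsionlessClasses.of_isBiregular [IsArtinianRing A] [IsArtinianRing B] {d : D}
    (hd : IsBiregular A B d) {n : ℕ} (h : TorsionlessClasses A n) : TorsionlessClasses B n := by
  obtain ⟨L, hL, hne, hcompl⟩ := h
  choose M hM hLM using fun i => hd.exists_corresponds (hL i)
  refine ⟨M, hM, fun i j hij => ⟨fun a => ?_⟩, fun N hN hNt hNi => ?_⟩
  · obtain ⟨b⟩ := (hLM i).symm.nonempty_equiv_right (hM i).2.2.1 (hL i).2.2.1 (hL j).2.2.1
      (hLM j).symm a
    exact (hne i j hij).false b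
  · obtain ⟨X, hX, hNX⟩ := hd.symm.exists_corresponds (X := N) ⟨hN, hNt, hNi⟩
    obtain ⟨i, ⟨a⟩⟩ := hcompl X hX.1 hX.2.1 hX.2.2
    exact ⟨i, hNX.symm.nonempty_equiv_right hX.2.2.1 hNi.1 (hM i).2.2.1 (hLM i) a⟩

end Correspondence

end Duality

theorem TorsionlessClasses.torsionlessFinite {A : Type u} [Ring A] {n : ℕ}
    (h : TorsionlessClasses A n) : TorsionlessFinite A := by
  obtain ⟨L, -, -, hL⟩ := h
  exact ⟨n, L, hL⟩

theorem TorsionlessFinite.exists_torsionlessClasses {A : Type u} [Ring A]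
    (h : TorsionlessFinite A) : ∃ n, TorsionlessClasses A n := by
  obtain ⟨m, L, hL⟩ := h
  let S : Setoid {X : ModuleCat.{u} A // IsTorsionlessIndec X} :=
    { r := fun X Y => Nonempty (X.1 ≃ₗ[A] Y.1)
      iseqv := ⟨fun X => ⟨LinearEquiv.refl A X.1⟩, fun ⟨a⟩ => ⟨a.symm⟩,
        fun ⟨a⟩ ⟨b⟩ => ⟨a.trans b⟩⟩ }
  choose c hc using fun X : {X : ModuleCat.{u} A // IsTorsionlessIndec X} =>
    hL X.1 X.2.1 X.2.2.1 X.2.2.2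
  have : Finite (Quotient S) := by
    refine Finite.of_injective (fun x : Quotient S => c x.out) fun x y hxy => ?_
    obtain ⟨a⟩ := hc x.out
    obtain ⟨b⟩ := hc y.out
    have hxy' : c x.out = c y.out := hxy
    rw [← hxy'] at b
    exact Quotient.out_equiv_out.mp ⟨a.trans b.symm⟩
  let E := Finite.equivFin (Quotient S)
  refine ⟨Nat.card (Quotient S), fun i => (E.symm i).out.1, fun i => (E.symm i).out.2,
    fun i j hij => ⟨fun a => hij ?_⟩, fun N hN hNt hNi => ?_⟩
  · exact E.symm.injective (Quotient.out_equiv_out.mp ⟨a⟩)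
  · let Z : {X : ModuleCat.{u} A // IsTorsionlessIndec X} := ⟨N, hN, hNt, hNi⟩
    refine ⟨E ⟦Z⟧, ?_⟩
    have h : E.symm (E ⟦Z⟧) = ⟦Z⟧ := E.symm_apply_apply _
    beta_reduce
    rw [h]
    exact Setoid.symm (Quotient.mk_out (s := S) Z)

/-- If `Λ` is torsionless-finite then so is `Λᵒᵖ`, with the same number of isomorphism
classes of indecomposable torsionless modules. -/
theorem stmt10 (k : Type u) [CommRing k] [IsArtinianRing k]
    (Λ : Type u) [Ring Λ] [Algebra k Λ] [Module.Finite k Λ]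
    (hTF : TorsionlessFinite Λ) :
    TorsionlessFinite Λᵐᵒᵖ ∧
      ∃ n : ℕ, TorsionlessClasses Λ n ∧ TorsionlessClasses Λᵐᵒᵖ n := by
  have : IsArtinianRing Λ := isArtinian_of_tower k (inferInstanceAs (IsArtinian k Λ))
  have : IsArtinianRing Λᵐᵒᵖ := isArtinian_of_tower k (inferInstanceAs (IsArtinian k Λᵐᵒᵖ))
  have hd : IsBiregular Λ Λᵐᵒᵖ (1 : Λ) := by
    constructor
    · exact ⟨fun a b hab => by simpa using hab, fun a => ⟨a, by simp⟩⟩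
    · exact ⟨fun a b hab => by simpa using hab, fun a => ⟨MulOpposite.op a, by simp⟩⟩
  obtain ⟨n, hn⟩ := hTF.exists_torsionlessClasses
  have hn' := hn.of_isBiregular hd
  exact ⟨hn'.torsionlessFinite, n, hn, hn'⟩
end

section
/- Let Λ be an artin algebra, P an indecomposable projective-injective Λ-module, I a minimal two-sided ideal with IP ≠ 0, and Λ' = Λ/I. Then every indecomposable Λ-module not isomorphic to P is annihilated by I, and if Λ' is not semisimple then repdim Λ ≤ repdim Λ'. -/
open CategoryTheory

universe u

namespace Submodule

/-- Disjoint submodules of an injective module can be enlarged to complementary ones. -/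
theorem exists_isCompl_ge_of_injective {R W : Type u} [Ring R] [AddCommGroup W] [Module R W]
    [Module.Injective R W] {A B : Submodule R W} (h : Disjoint A B) :
    ∃ E D : Submodule R W, A ≤ E ∧ B ≤ D ∧ IsCompl E D := by
  have key : ∀ A B : Submodule R W, Disjoint A B →
      ∃ E, A ≤ E ∧ Maximal (· ∈ {E : Submodule R W | Disjoint E B}) E := by
    intro A B h
    refine zorn_le_nonempty₀ _ (fun c hc hch y hy ↦ ⟨sSup c, ?_, fun z hz ↦ le_sSup hz⟩) A h
    exact hch.directedOn.disjoint_sSup_left.2 fun z hz ↦ hc hz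
  obtain ⟨E, hAE, hE⟩ := key A B h
  obtain ⟨D, hBD, hD⟩ := key B E hE.prop.symm
  have hED : Disjoint E D := hD.prop.symm
  refine ⟨E, D, hAE, hBD, hED, ?_⟩
  have hinj : Function.Injective (D.mkQ.comp E.subtype) := by
    rw [← LinearMap.ker_eq_bot, LinearMap.ker_comp, ker_mkQ]
    exact (Submodule.disjoint_iff_comap_eq_bot).1 hED
  obtain ⟨g, hg⟩ := Module.Injective.out (D.mkQ.comp E.subtype) hinj E.subtype
  have hg' : ∀ x ∈ E, g (D.mkQ x) = x := fun x hx ↦ hg ⟨x, hx⟩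
  have hN : D.comap (g.comp D.mkQ) = D := by
    refine le_antisymm (hD.le_of_ge ?_ ?_) ?_
    · refine Submodule.disjoint_def.2 fun x hx hxE ↦ ?_
      rw [mem_comap, LinearMap.comp_apply, hg' x hxE] at hx
      exact Submodule.disjoint_def.1 hED x hxE hx
    all_goals
      intro x hx
      have : D.mkQ x = 0 := by simpa using hx
      simp [this]
  have hN' : ∀ w, g (D.mkQ w) ∈ D → w ∈ D := fun w hw ↦ by
    rw [← hN]; exact hw
  have hr : LinearMap.range g = E := by
    refine le_antisymm (hE.le_of_ge ?_ ?_) ?_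
    · refine Submodule.disjoint_def.2 ?_
      rintro _ ⟨z, rfl⟩ hz
      obtain ⟨w, rfl⟩ := D.mkQ_surjective z
      have : D.mkQ w = 0 := by simpa using hN' w (hBD hz)
      rw [this, map_zero]
    all_goals exact fun x hx ↦ ⟨D.mkQ x, hg' x hx⟩
  rw [codisjoint_iff, eq_top_iff]
  intro w _
  have hw : g (D.mkQ w) ∈ E := hr ▸ LinearMap.mem_range_self g _
  refine mem_sup.2 ⟨_, hw, w - g (D.mkQ w), hN' _ ?_, by abel⟩
  rw [map_sub, map_sub, hg' _ hw, sub_self]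
  exact zero_mem _

end Submodule

section ProjectiveInjective

variable {Λ : Type u} [Ring Λ] {P : Type u} [AddCommGroup P] [Module Λ P]

theorem Indec.eq_bot_or_eq_bot_of_disjoint [Module.Injective Λ P] (hP : Indec Λ P)
    {A B : Submodule Λ P} (h : Disjoint A B) : A = ⊥ ∨ B = ⊥ := by
  obtain ⟨E, D, hA, hB, hED⟩ := Submodule.exists_isCompl_ge_of_injective h
  set e : Module.End Λ P := E.subtype.comp (E.projectionOnto D hED) with he
  have hee : e * e = e := by
    ext x
    simp [he]
  rcases hP.2 e hee with h0 | h1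
  · left
    refine (Submodule.eq_bot_iff _).2 fun x hx ↦ ?_
    have := LinearMap.congr_fun h0 x
    rwa [he, LinearMap.comp_apply, Submodule.projectionOnto_apply_left hED ⟨x, hA hx⟩]
      at this
  · right
    refine (Submodule.eq_bot_iff _).2 fun x hx ↦ ?_
    have := LinearMap.congr_fun h1 x
    rw [he, LinearMap.comp_apply, Submodule.projectionOnto_apply_of_mem_right hED (hB hx)]
      at this
    simpa using this.symm

/-- An indecomposable injective artinian module has an element which is killed by all
noninjective maps. -/
theorem Indec.exists_map_eq_zero [Module.Injective Λ P] [IsArtinian Λ P] (hP : Indec Λ P) :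
    ∃ s : P, s ≠ 0 ∧ ∀ (X : Type u) [AddCommGroup X] [Module Λ X] (f : P →ₗ[Λ] X),
      ¬ Function.Injective f → f s = 0 := by
  have := hP.1
  obtain ⟨S, hS⟩ := IsAtomic.exists_atom (Submodule Λ P)
  obtain ⟨s, hs, hs0⟩ := S.exists_mem_ne_zero_of_ne_bot hS.1
  refine ⟨s, hs0, fun X _ _ f hf ↦ ?_⟩
  rw [← LinearMap.ker_eq_bot] at hf
  have : ¬ Disjoint S (LinearMap.ker f) := fun h ↦
    (hP.eq_bot_or_eq_bot_of_disjoint h).elim hS.1 hf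
  exact hS.not_disjoint_iff_le.1 this hs

/-- A two-sided ideal which is minimal among those not annihilating the indecomposable
projective-injective module `P` annihilates all modules in which `P` does not embed. -/
theorem TwoSidedIdeal.smul_eq_zero_of_not_injective [Module.Injective Λ P] [IsArtinian Λ P]
    [Module.Projective Λ P] (hP : Indec Λ P) {I : TwoSidedIdeal Λ}
    (hIP : ∃ a ∈ I, ∃ x : P, a • x ≠ 0)
    (hmin : ∀ I' : TwoSidedIdeal Λ, I' ≤ I → (∃ a ∈ I', ∃ x : P, a • x ≠ 0) → I' = I)
    {X : Type u} [AddCommGroup X] [Module Λ X] (hX : ∀ f : P →ₗ[Λ] X, ¬ Function.Injective f)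
    {a : Λ} (ha : a ∈ I) (x : X) : a • x = 0 := by
  obtain ⟨s, hs0, hs⟩ := hP.exists_map_eq_zero
  obtain ⟨σ, hσ⟩ := Module.projective_def.1 (inferInstance : Module.Projective Λ P)
  obtain ⟨p, hp⟩ : ∃ p : P, σ s p • p ≠ 0 := by
    by_contra! h
    apply hs0
    rw [← hσ s, Finsupp.linearCombination_apply]
    exact Finset.sum_eq_zero fun p _ ↦ h p
  have kill : ∀ {Y : Type u} [AddCommGroup Y] [Module Λ Y],
      (∀ f : P →ₗ[Λ] Y, ¬ Function.Injective f) → ∀ y : Y, σ s p • y = 0 := by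
    intro Y _ _ hY y
    exact hs Y ((LinearMap.toSpanSingleton Λ Y y).comp ((Finsupp.lapply p).comp σ)) (hY _)
  have hmem : σ s p ∈ I := by
    have hq : ∀ f : P →ₗ[Λ] (Λ ⧸ I.asIdeal), ¬ Function.Injective f := by
      intro f hf
      obtain ⟨b, hb, z, hz⟩ := hIP
      refine hz (hf ?_)
      rw [map_smul, map_zero]
      obtain ⟨w, hw⟩ := Submodule.Quotient.mk_surjective _ (f z)
      rw [← hw, ← Submodule.Quotient.mk_smul, Submodule.Quotient.mk_eq_zero]
      exact I.mul_mem_right _ _ hb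
    have := kill hq (Submodule.Quotient.mk 1)
    rw [← Submodule.Quotient.mk_smul, Submodule.Quotient.mk_eq_zero, smul_eq_mul, mul_one] at this
    exact this
  have hspan : TwoSidedIdeal.span {σ s p} = I := by
    refine hmin _ (TwoSidedIdeal.span_le.2 ?_) ⟨σ s p, TwoSidedIdeal.subset_span rfl, p, hp⟩
    rintro _ rfl
    exact hmem
  let K : TwoSidedIdeal Λ := TwoSidedIdeal.mk' {r | ∀ x : X, r • x = 0} (by simp)
    (fun h h' x ↦ by rw [add_smul, h, h', add_zero]) (fun h x ↦ by rw [neg_smul, h, neg_zero])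
    (fun h x ↦ by rw [mul_smul, h, smul_zero]) (fun h x ↦ by rw [mul_smul, h])
  have hK : I ≤ K := by
    rw [← hspan]
    refine TwoSidedIdeal.span_le.2 ?_
    rintro _ rfl
    exact (TwoSidedIdeal.mem_mk' ..).2 (kill hX)
  exact (TwoSidedIdeal.mem_mk' ..).1 (hK ha) x

theorem Indec.nonempty_linearEquiv_of_injective [Module.Injective Λ P] (hP : Nontrivial P)
    {N : Type u} [AddCommGroup N] [Module Λ N] (hN : Indec Λ N) (f : P →ₗ[Λ] N)
    (hf : Function.Injective f) : Nonempty (N ≃ₗ[Λ] P) := by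
  obtain ⟨r, hr⟩ := Module.Injective.out f hf (LinearMap.id : P →ₗ[Λ] P)
  have hr' : ∀ x, r (f x) = x := hr
  rcases hN.2 (f.comp r) (by ext x; simp [hr']) with h | h
  · obtain ⟨x, hx⟩ := exists_ne (0 : P)
    refine absurd (hf ?_) hx
    rw [map_zero]
    simpa [hr'] using LinearMap.congr_fun h (f x)
  · exact ⟨LinearEquiv.ofLinearMap r f (LinearMap.ext hr') h⟩

/-- Induction principle for finite length modules: split off copies of the injective
module `P` as long as possible. -/
theorem Module.Injective.induction_of_splitting [Module.Injective Λ P] [Nontrivial P]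
    [IsArtinianRing Λ] (Q : ∀ (C : Type u) [AddCommGroup C] [Module Λ C], Prop)
    (hQ : ∀ (C : Type u) [AddCommGroup C] [Module Λ C], Module.Finite Λ C →
      (∀ f : P →ₗ[Λ] C, ¬ Function.Injective f) → Q C)
    (hstep : ∀ (C C' : Type u) [AddCommGroup C] [Module Λ C] [AddCommGroup C'] [Module Λ C'],
      Module.Finite Λ C → Module.Finite Λ C' → Nonempty (C ≃ₗ[Λ] P × C') → Q C' → Q C)
    (C : Type u) [AddCommGroup C] [Module Λ C] [Module.Finite Λ C] : Q C := by
  suffices H : ∀ (n : ℕ) (C : Type u) [AddCommGroup C] [Module Λ C], Module.Finite Λ C →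
      Module.length Λ C ≤ n → Q C by
    obtain ⟨n, hn⟩ := ENat.ne_top_iff_exists.1 (Module.length_ne_top (R := Λ) (M := C))
    exact H n C inferInstance hn.ge
  intro n
  induction n with
  | zero =>
    intro C _ _ hC hn
    have : Subsingleton C := Module.length_eq_zero_iff.1 (le_antisymm hn bot_le)
    exact hQ C hC fun f hf ↦ not_subsingleton P hf.subsingleton
  | succ n ih =>
    intro C _ _ hC hn
    by_cases h : ∃ f : P →ₗ[Λ] C, Function.Injective f
    · obtain ⟨f, hf⟩ := h
      obtain ⟨r, hr⟩ := Module.Injective.out f hf (LinearMap.id : P →ₗ[Λ] P)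
      have hr' : ∀ x, r (f x) = x := hr
      let φ : C →ₗ[Λ] LinearMap.ker r := (LinearMap.id - f.comp r).codRestrict _
        (fun x ↦ by simp [hr'])
      let e : C ≃ₗ[Λ] P × LinearMap.ker r := LinearEquiv.ofLinearMap (r.prod φ)
        (f.coprod (LinearMap.ker r).subtype)
        (LinearMap.ext fun ⟨x, y, hy⟩ ↦ by
          have : r y = 0 := hy
          ext <;> simp [φ, hr', this])
        (LinearMap.ext fun x ↦ by simp [φ])
      refine hstep C _ hC inferInstance ⟨e⟩ (ih _ inferInstance ?_)
      rw [e.length_eq, Module.length_prod] at hn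
      have h1 : 1 ≤ Module.length Λ P := Order.one_le_iff_pos.2 Module.length_pos
      have : 1 + Module.length Λ (LinearMap.ker r) ≤ 1 + n := by
        refine (add_le_add_left h1 _).trans (hn.trans ?_)
        rw [add_comm]; push_cast; rfl
      exact (ENat.add_le_add_iff_left (by simp)).1 this
    · exact hQ C hC fun f hf ↦ h ⟨f, hf⟩

end ProjectiveInjective


section EnoughFiniteInjectives

theorem Module.Injective.of_retract {R : Type u} [Ring R] {M N : Type u} [AddCommGroup M]
    [Module R M] [AddCommGroup N] [Module R N] [Module.Injective R M] (i : N →ₗ[R] M)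
    (p : M →ₗ[R] N) (h : ∀ x, p (i x) = x) : Module.Injective R N where
  out X Y _ _ _ _ f hf g := by
    obtain ⟨l, hl⟩ := Module.Injective.out f hf (i.comp g)
    exact ⟨p.comp l, fun x ↦ by simp [hl, h]⟩

theorem Module.finite_of_torsionBySet {k E : Type*} [CommRing k] [IsNoetherianRing k]
    [AddCommGroup E] [Module k E] {J : Ideal k} (hJ : IsNilpotent J)
    [Module.Finite k (Submodule.torsionBySet k E J)] : Module.Finite k E := by
  obtain ⟨s, hs⟩ := (isNoetherian_def.1 (inferInstance : IsNoetherian k k)) J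
  have key : ∀ i : ℕ, IsNoetherian k (Submodule.torsionBySet k E (J ^ i : Ideal k)) := by
    intro i
    induction i with
    | zero =>
      have : Subsingleton (Submodule.torsionBySet k E (J ^ 0 : Ideal k)) := by
        refine ⟨fun x y ↦ ?_⟩
        have h := fun z : Submodule.torsionBySet k E (J ^ 0 : Ideal k) ↦
          (Submodule.mem_torsionBySet_iff _ _).1 z.2 ⟨1, by simp⟩
        ext
        simpa using (h x).trans (h y).symm
      infer_instance
    | succ i ih =>
      let φ : Submodule.torsionBySet k E (J ^ (i + 1) : Ideal k) →ₗ[k]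
          (s → Submodule.torsionBySet k E (J ^ i : Ideal k)) :=
        LinearMap.pi fun j ↦ ((LinearMap.lsmul k E j).comp (Submodule.subtype _)).codRestrict _
          (fun x ↦ (Submodule.mem_torsionBySet_iff _ _).2 fun a ↦ by
            have hj : (j : k) ∈ J := hs ▸ Submodule.subset_span j.2
            have := (Submodule.mem_torsionBySet_iff _ _).1 x.2
              ⟨a * j, by rw [pow_succ]; exact Ideal.mul_mem_mul a.2 hj⟩
            simpa [mul_smul] using this)
      have hker : ∀ x : LinearMap.ker φ, (x : E) ∈ Submodule.torsionBySet k E J := by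
        intro x
        refine (Submodule.mem_torsionBySet_iff _ _).2 fun a ↦ ?_
        have hle : J ≤ Ideal.torsionOf k E (x : E) := by
          refine hs.ge.trans (Submodule.span_le.2 fun j hj ↦ (Ideal.mem_torsionOf_iff _ _).2 ?_)
          exact congrArg Subtype.val (congrFun (LinearMap.mem_ker.1 x.2) ⟨j, hj⟩)
        exact (Ideal.mem_torsionOf_iff _ _).1 (hle a.2)
      have : IsNoetherian k (LinearMap.ker φ) :=
        isNoetherian_of_injective (((Submodule.subtype _).comp
          (LinearMap.ker φ).subtype).codRestrict (Submodule.torsionBySet k E J) hker)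
          fun x y h ↦ Subtype.ext (Subtype.ext (congrArg (fun z ↦ (z.1 : E)) h))
      exact isNoetherian_of_range_eq_ker (LinearMap.ker φ).subtype φ (Submodule.range_subtype _)
  obtain ⟨n, hn⟩ := hJ
  have := key n
  have htop : Submodule.torsionBySet k E (J ^ n : Ideal k) = ⊤ := by
    refine eq_top_iff.2 fun x _ ↦ (Submodule.mem_torsionBySet_iff _ _).2 ?_
    rintro ⟨a, ha⟩
    rw [hn] at ha
    simp only [Submodule.zero_eq_bot, Submodule.bot_coe, Set.mem_singleton_iff] at ha
    simp [ha]
  rw [htop] at this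
  have := isNoetherian_top_iff.1 this
  infer_instance

/-- Over a commutative artinian ring, every simple module `k ⧸ m` embeds into a finitely
generated injective module. -/
theorem Ideal.IsMaximal.exists_finite_injective {k : Type u} [CommRing k] [IsArtinianRing k]
    {m : Ideal k} (hm : m.IsMaximal) :
    ∃ (E : ModuleCat.{u} k) (j : (k ⧸ m) →ₗ[k] E), Module.Finite k E ∧ Module.Injective k E ∧
      Function.Injective j := by
  let W : ModuleCat.{u} k := CategoryTheory.Injective.under (ModuleCat.of k (k ⧸ m))
  have : Module.Injective k W := (Module.injective_iff_injective_object k W).2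
    (inferInstanceAs (CategoryTheory.Injective (CategoryTheory.Injective.under _)))
  let ι : (k ⧸ m) →ₗ[k] W := (CategoryTheory.Injective.ι (ModuleCat.of k (k ⧸ m))).hom
  have hι : Function.Injective ι := (ModuleCat.mono_iff_injective _).1 inferInstance
  let J := Ring.jacobson k
  let N := Submodule.torsionBySet k W J
  have hN : IsSemisimpleModule k N := by
    have h := Submodule.torsionBySet_isTorsionBySet (R := k) (M := W) (J : Set k)
    rw [← Module.IsTorsionBySet.isSemisimpleModule_iff (I := J) h]
    let _ := h.module (I := J)
    infer_instance
  have hT : LinearMap.range ι ≤ N := by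
    rintro _ ⟨y, rfl⟩
    refine (Submodule.mem_torsionBySet_iff _ _).2 fun a ↦ ?_
    obtain ⟨r, rfl⟩ := Ideal.Quotient.mk_surjective y
    have ha : (a : k) ∈ m := by
      have : (a : k) ∈ Ring.jacobson k := a.2
      rw [Ring.jacobson_eq_sInf_isMaximal] at this
      exact Submodule.mem_sInf.1 this m hm
    rw [← map_smul, Algebra.smul_def, Ideal.Quotient.algebraMap_eq, ← map_mul,
      Ideal.Quotient.eq_zero_iff_mem.2 (m.mul_mem_right _ ha), map_zero]
  obtain ⟨C, hC⟩ := exists_isCompl ((LinearMap.range ι).comap N.subtype)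
  have hdisj : Disjoint (LinearMap.range ι) (C.map N.subtype) := by
    refine Submodule.disjoint_def.2 ?_
    rintro _ hx ⟨y, hy, rfl⟩
    simpa using Submodule.disjoint_def.1 hC.1 y hx hy
  obtain ⟨E, D, hE, hD, hED⟩ := Submodule.exists_isCompl_ge_of_injective hdisj
  refine ⟨ModuleCat.of k E, ι.codRestrict E fun x ↦ hE (LinearMap.mem_range_self _ x), ?_, ?_, ?_⟩
  · have hle : ∀ x ∈ E, x ∈ N → x ∈ LinearMap.range ι := by
      intro x hxE hxN
      have : (⟨x, hxN⟩ : N) ∈ (LinearMap.range ι).comap N.subtype ⊔ C := by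
        rw [hC.sup_eq_top]; trivial
      obtain ⟨y, hy, z, hz, hyz⟩ := Submodule.mem_sup.1 this
      have hyz' : (y : W) + z = x := congrArg Subtype.val hyz
      have hzE : (z : W) ∈ E := by
        rw [← hyz'] at hxE
        exact (Submodule.add_mem_iff_right _ (hE hy)).1 hxE
      have : (z : W) = 0 := Submodule.disjoint_def.1 hED.1 _ hzE (hD ⟨z, hz, rfl⟩)
      rw [← hyz', this, add_zero]
      exact hy
    have : Module.Finite k (Submodule.torsionBySet k E J) := by
      refine Module.Finite.of_injective ((E.subtype.comp (Submodule.subtype _)).codRestrict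
        (LinearMap.range ι) fun x ↦ hle _ x.1.2 ?_)
        fun x y h ↦ Subtype.ext (Subtype.ext (by simpa using congrArg Subtype.val h))
      refine (Submodule.mem_torsionBySet_iff _ _).2 fun a ↦ ?_
      exact congrArg Subtype.val ((Submodule.mem_torsionBySet_iff _ _).1 x.2 a)
    exact Module.finite_of_torsionBySet (IsSemiprimaryRing.isNilpotent (R := k))
  · exact Module.Injective.of_retract E.subtype (E.projectionOnto D hED)
      fun x ↦ Submodule.projectionOnto_apply_left hED x
  · exact fun x y h ↦ hι (congrArg Subtype.val h)

/-- The module over an algebra `Λ` coinduced from a `k`-module. -/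
def Coinduced (k Λ E : Type*) [CommRing k] [Ring Λ] [Algebra k Λ] [AddCommGroup E] [Module k E] :
    Type _ :=
  Λ →ₗ[k] E

namespace Coinduced

variable {k Λ E : Type*} [CommRing k] [Ring Λ] [Algebra k Λ] [AddCommGroup E] [Module k E]

instance : AddCommGroup (Coinduced k Λ E) := inferInstanceAs (AddCommGroup (Λ →ₗ[k] E))

instance : Module k (Coinduced k Λ E) := inferInstanceAs (Module k (Λ →ₗ[k] E))

/-- Evaluation of an element of the coinduced module. -/
def eval (s : Λ) : Coinduced k Λ E →ₗ[k] E := LinearMap.applyₗ (M := Λ) s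

theorem ext {φ ψ : Coinduced k Λ E} (h : ∀ s, eval s φ = eval s ψ) : φ = ψ :=
  LinearMap.ext (f := (φ : Λ →ₗ[k] E)) h

theorem eval_add (s t : Λ) (φ : Coinduced k Λ E) : eval (s + t) φ = eval s φ + eval t φ :=
  LinearMap.map_add (φ : Λ →ₗ[k] E) s t

theorem eval_smul_left (r : k) (s : Λ) (φ : Coinduced k Λ E) : eval (r • s) φ = r • eval s φ :=
  LinearMap.map_smul (φ : Λ →ₗ[k] E) r s

instance : SMul Λ (Coinduced k Λ E) where
  smul a φ := LinearMap.comp (M₁ := Λ) φ (LinearMap.mulRight k a)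

theorem eval_smul (s a : Λ) (φ : Coinduced k Λ E) : eval s (a • φ) = eval (s * a) φ := rfl

instance : Module Λ (Coinduced k Λ E) where
  one_smul φ := ext fun s ↦ by rw [eval_smul, mul_one]
  mul_smul a b φ := ext fun s ↦ by simp only [eval_smul, mul_assoc]
  smul_zero _ := rfl
  smul_add _ _ _ := rfl
  add_smul a b φ := ext fun s ↦ by simp only [eval_smul, mul_add, eval_add, map_add]
  zero_smul φ := ext fun s ↦ by
    rw [eval_smul, mul_zero, map_zero]
    exact LinearMap.map_zero (φ : Λ →ₗ[k] E)

instance : IsScalarTower k Λ (Coinduced k Λ E) where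
  smul_assoc r a φ := ext fun s ↦ by
    rw [eval_smul, mul_smul_comm, eval_smul_left, map_smul, eval_smul]

theorem finite [IsNoetherianRing k] [Module.Finite k Λ] [Module.Finite k E] :
    Module.Finite Λ (Coinduced k Λ E) := by
  obtain ⟨n, s, hs⟩ := Module.Finite.exists_fin (R := k) (M := Λ)
  let ev : (Λ →ₗ[k] E) →ₗ[k] (Fin n → E) := LinearMap.pi fun i ↦ LinearMap.applyₗ (s i)
  have hev : Function.Injective ev := fun φ ψ h ↦ LinearMap.ext_on hs (by
    rintro _ ⟨i, rfl⟩
    exact congrFun h i)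
  have : Module.Finite k (Coinduced k Λ E) := Module.Finite.of_injective ev hev
  exact Module.Finite.of_restrictScalars_finite k Λ _

/-- The adjunction between restriction and coinduction. -/
def lift {X : Type*} [AddCommGroup X] [Module k X] [Module Λ X] [IsScalarTower k Λ X]
    (g : X →ₗ[k] E) : X →ₗ[Λ] Coinduced k Λ E where
  toFun x := (g.comp ((LinearMap.toSpanSingleton Λ X x).restrictScalars k) : Λ →ₗ[k] E)
  map_add' x y := ext fun s ↦ (congrArg g (smul_add s x y)).trans (map_add g _ _)
  map_smul' a x := ext fun s ↦ congrArg g (smul_smul s a x)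

theorem eval_lift {X : Type*} [AddCommGroup X] [Module k X] [Module Λ X] [IsScalarTower k Λ X]
    (g : X →ₗ[k] E) (x : X) (s : Λ) : eval s (lift g x) = g (s • x) := rfl

theorem injective {k Λ E : Type u} [CommRing k] [Ring Λ] [Algebra k Λ] [AddCommGroup E]
    [Module k E] [Module.Injective k E] : Module.Injective Λ (Coinduced k Λ E) where
  out X Y _ _ _ _ f hf g := by
    let _ : Module k X := Module.compHom X (algebraMap k Λ)
    let _ : Module k Y := Module.compHom Y (algebraMap k Λ)
    have : IsScalarTower k Λ X := ⟨fun r a x ↦ by rw [Algebra.smul_def, mul_smul]; rfl⟩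
    have : IsScalarTower k Λ Y := ⟨fun r a x ↦ by rw [Algebra.smul_def, mul_smul]; rfl⟩
    obtain ⟨h, hh⟩ := Module.Injective.out (f.restrictScalars k) hf
      ((eval 1).comp (g.restrictScalars k))
    refine ⟨lift h, fun x ↦ ext fun s ↦ ?_⟩
    rw [eval_lift, ← map_smul]
    refine (hh (s • x)).trans ?_
    simp [eval_smul]

end Coinduced

/-- Modules over an artin algebra are separated by maps to finitely generated injectives. -/
theorem exists_finite_injective_map_ne_zero (k : Type u) [CommRing k] [IsArtinianRing k]
    {Λ : Type u} [Ring Λ] [Algebra k Λ] [Module.Finite k Λ]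
    {X : Type u} [AddCommGroup X] [Module Λ X] {x : X} (hx : x ≠ 0) :
    ∃ (Q : ModuleCat.{u} Λ) (h : X →ₗ[Λ] Q), Module.Finite Λ Q ∧ Module.Injective Λ Q ∧
      h x ≠ 0 := by
  let _ : Module k X := Module.compHom X (algebraMap k Λ)
  have : IsScalarTower k Λ X := ⟨fun r a x ↦ by rw [Algebra.smul_def, mul_smul]; rfl⟩
  obtain ⟨m, hm, hle⟩ := Ideal.exists_le_maximal (Ideal.torsionOf k X x)
    (by rwa [Ne, Ideal.torsionOf_eq_top_iff])
  obtain ⟨E, j, hEf, hEi, hj⟩ := hm.exists_finite_injective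
  let g₀ : Submodule.span k {x} →ₗ[k] E := (j.comp (Submodule.factor hle)).comp
    (Ideal.quotTorsionOfEquivSpanSingleton k X x).symm.toLinearMap
  obtain ⟨g, hg⟩ := Module.Injective.out (Submodule.subtype _) Subtype.val_injective g₀
  have hgx : g x ≠ 0 := by
    have h1 := hg ⟨x, Submodule.mem_span_singleton_self x⟩
    rw [Submodule.subtype_apply] at h1
    rw [h1]
    have h2 : (⟨x, Submodule.mem_span_singleton_self x⟩ : Submodule.span k {x}) =
        Ideal.quotTorsionOfEquivSpanSingleton k X x (Submodule.Quotient.mk 1) := by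
      ext
      rw [Ideal.quotTorsionOfEquivSpanSingleton_apply_mk]
      exact (one_smul k x).symm
    rw [h2]
    simp only [g₀, LinearMap.comp_apply, LinearEquiv.coe_coe, LinearEquiv.symm_apply_apply]
    rw [Ne, ← map_zero j, hj.eq_iff]
    intro h
    exact (Ideal.ne_top_iff_one m).1 hm.ne_top ((Submodule.Quotient.mk_eq_zero m).1 h)
  refine ⟨ModuleCat.of Λ (Coinduced k Λ E), Coinduced.lift g, Coinduced.finite,
    Coinduced.injective, fun h ↦ hgx ?_⟩
  rw [← one_smul Λ x, ← Coinduced.eval_lift, h, map_zero]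

end EnoughFiniteInjectives

section ProjectiveDimension

variable (E : Type u) [Ring E]

/-- The projective dimension of the module `Y` is at most `n`. -/
def PdLE (Y : Type u) [AddCommGroup Y] [Module E Y] (n : ℕ) : Prop :=
  HasProjectiveDimensionLT (ModuleCat.of.{u} E Y) (n + 1)

namespace PdLE

variable {E} {A B C : Type u} [AddCommGroup A] [Module E A] [AddCommGroup B] [Module E B]
  [AddCommGroup C] [Module E C] {n : ℕ}

theorem zero_iff : PdLE E A 0 ↔ Module.Projective E A :=
  (projective_iff_hasProjectiveDimensionLT_one).symm.trans (IsProjective.iff_projective A).symm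

theorem mono {m : ℕ} (h : PdLE E A m) (hmn : m ≤ n) : PdLE E A n := by
  have : HasProjectiveDimensionLT (ModuleCat.of.{u} E A) (m + 1) := h
  exact hasProjectiveDimensionLT_of_ge _ (m + 1) (n + 1) (by lia)

theorem of_projective [h : Module.Projective E A] : PdLE E A n :=
  (zero_iff.2 h).mono n.zero_le

theorem congr (e : A ≃ₗ[E] B) (h : PdLE E A n) : PdLE E B n := by
  have : HasProjectiveDimensionLT (ModuleCat.of.{u} E A) (n + 1) := h
  exact hasProjectiveDimensionLT_of_iso e.toModuleIso (n + 1)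

theorem shortExact {f : A →ₗ[E] B} {g : B →ₗ[E] C} (hf : Function.Injective f)
    (hfg : Function.Exact f g) (hg : Function.Surjective g) :
    (ModuleCat.shortComplexOfCompEqZero f g hfg.linearMap_comp_eq_zero).ShortExact :=
  ModuleCat.shortComplex_shortExact _ hfg hf hg

theorem middle {f : A →ₗ[E] B} {g : B →ₗ[E] C} (hf : Function.Injective f)
    (hfg : Function.Exact f g) (hg : Function.Surjective g) (hA : PdLE E A n) (hC : PdLE E C n) :
    PdLE E B n :=
  (shortExact hf hfg hg).hasProjectiveDimensionLT_X₂ (n + 1) hA hC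

theorem right [Module.Projective E B] {f : A →ₗ[E] B} {g : B →ₗ[E] C} (hf : Function.Injective f)
    (hfg : Function.Exact f g) (hg : Function.Surjective g) (hA : PdLE E A n) :
    PdLE E C (n + 1) :=
  (shortExact hf hfg hg).hasProjectiveDimensionLT_X₃ (n + 1) hA (of_projective (n := n + 1))

theorem left [Module.Projective E B] {f : A →ₗ[E] B} {g : B →ₗ[E] C} (hf : Function.Injective f)
    (hfg : Function.Exact f g) (hg : Function.Surjective g) (hC : PdLE E C (n + 1)) :
    PdLE E A n :=
  (shortExact hf hfg hg).hasProjectiveDimensionLT_X₁ (n + 1) (of_projective (n := n)) hC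

theorem ker_of_surjective [Module.Projective E B] {g : B →ₗ[E] C} (hg : Function.Surjective g)
    (hC : PdLE E C (n + 1)) : PdLE E (LinearMap.ker g) n :=
  left (Submodule.subtype_injective _) g.exact_subtype_ker_map hg hC

theorem of_ker [Module.Projective E B] {g : B →ₗ[E] C} (hg : Function.Surjective g)
    (h : PdLE E (LinearMap.ker g) n) : PdLE E C (n + 1) :=
  right (Submodule.subtype_injective _) g.exact_subtype_ker_map hg h

theorem range_of_quotient [Module.Projective E B] {g : A →ₗ[E] B}
    (h : PdLE E (B ⧸ LinearMap.range g) (n + 1)) : PdLE E (LinearMap.range g) n :=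
  left (Submodule.subtype_injective _) (LinearMap.exact_subtype_mkQ _)
    (Submodule.mkQ_surjective _) h

theorem ker_of_quotient_range [Module.Projective E A] [Module.Projective E B] {g : A →ₗ[E] B}
    (h : PdLE E (B ⧸ LinearMap.range g) (n + 2)) : PdLE E (LinearMap.ker g) n := by
  have := ker_of_surjective (g := g.rangeRestrict) g.surjective_rangeRestrict (range_of_quotient h)
  rwa [LinearMap.ker_rangeRestrict] at this

theorem quotient_range_of_ker [Module.Projective E A] [Module.Projective E B] {g : A →ₗ[E] B}
    (h : PdLE E (LinearMap.ker g) n) : PdLE E (B ⧸ LinearMap.range g) (n + 2) := by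
  rw [← LinearMap.ker_rangeRestrict] at h
  exact right (Submodule.subtype_injective _) (LinearMap.exact_subtype_mkQ _)
    (Submodule.mkQ_surjective _) (of_ker g.surjective_rangeRestrict h)

end PdLE

theorem ProjDimLE.pdLE {E : Type u} [Ring E] {d : ℕ} {Y : ModuleCat.{u} E}
    (h : ProjDimLE E d Y) : PdLE E Y d := by
  induction d generalizing Y with
  | zero => exact PdLE.zero_iff.2 h
  | succ d ih =>
    obtain ⟨P, f, hP, -, hf, hK⟩ := h
    exact PdLE.of_ker hf (ih hK)

theorem PdLE.projDimLE {E : Type u} [Ring E] [IsNoetherianRing E] {d : ℕ} {Y : ModuleCat.{u} E}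
    [Module.Finite E Y] (h : PdLE E Y d) : ProjDimLE E d Y := by
  induction d generalizing Y with
  | zero => exact PdLE.zero_iff.1 h
  | succ d ih =>
    obtain ⟨n, f, hf⟩ := Module.Finite.exists_fin' E Y
    exact ⟨ModuleCat.of E (Fin n → E), f, inferInstanceAs (Module.Projective E (Fin n → E)),
      inferInstanceAs (Module.Finite E (Fin n → E)), hf, ih (PdLE.ker_of_surjective hf h)⟩

end ProjectiveDimension

section EndomorphismRing

section

variable {R : Type u} [Ring R]

theorem InAdd.pi {M N : Type u} [AddCommGroup M] [Module R M] [AddCommGroup N] [Module R N]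
    (h : InAdd R M N) (r : ℕ) : InAdd R M (Fin r → N) := by
  obtain ⟨n, i, p, hpi⟩ := h
  let e := (LinearEquiv.curry R M (Fin r) (Fin n)).symm.trans
    (LinearEquiv.funCongrLeft R M finProdFinEquiv.symm)
  refine ⟨r * n, e.toLinearMap.comp (LinearMap.pi fun j ↦ i.comp (LinearMap.proj j)),
    (LinearMap.pi fun j ↦ p.comp (LinearMap.proj j)).comp e.symm.toLinearMap, ?_⟩
  refine LinearMap.ext fun x ↦ ?_
  simp only [LinearMap.comp_apply, LinearEquiv.coe_coe, LinearEquiv.symm_apply_apply]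
  exact funext fun j ↦ LinearMap.congr_fun hpi (x j)

theorem InAdd.of_retract {M N K : Type u} [AddCommGroup M] [Module R M] [AddCommGroup N]
    [Module R N] [AddCommGroup K] [Module R K] (h : InAdd R M N) (s : K →ₗ[R] N) (t : N →ₗ[R] K)
    (hts : ∀ x, t (s x) = x) : InAdd R M K := by
  obtain ⟨n, i, p, hpi⟩ := h
  refine ⟨n, i.comp s, t.comp p, LinearMap.ext fun x ↦ ?_⟩
  have := LinearMap.congr_fun hpi (s x)
  simp only [LinearMap.comp_apply, LinearMap.id_apply] at this
  simp [this, hts]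

theorem InAdd.refl (M : Type u) [AddCommGroup M] [Module R M] : InAdd R M M :=
  ⟨1, LinearMap.pi fun _ ↦ LinearMap.id, LinearMap.proj 0, rfl⟩

theorem InAdd.trans {M N K : Type u} [AddCommGroup M] [Module R M] [AddCommGroup N]
    [Module R N] [AddCommGroup K] [Module R K] (h : InAdd R M N) (h' : InAdd R N K) :
    InAdd R M K := by
  obtain ⟨n, i, p, hpi⟩ := h'
  exact (h.pi n).of_retract i p (LinearMap.congr_fun hpi)

theorem InAdd.prod {M N K : Type u} [AddCommGroup M] [Module R M] [AddCommGroup N]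
    [Module R N] [AddCommGroup K] [Module R K] (h : InAdd R M N) (h' : InAdd R M K) :
    InAdd R M (N × K) := by
  obtain ⟨n, i, p, hpi⟩ := h
  obtain ⟨m, j, q, hqj⟩ := h'
  let e := (LinearEquiv.sumArrowLequivProdArrow (Fin n) (Fin m) R M).symm.trans
    (LinearEquiv.funCongrLeft R M finSumFinEquiv.symm)
  refine ⟨n + m, e.toLinearMap.comp (i.prodMap j), (p.prodMap q).comp e.symm.toLinearMap, ?_⟩
  refine LinearMap.ext fun x ↦ ?_
  simp only [LinearMap.comp_apply, LinearEquiv.coe_coe, LinearEquiv.symm_apply_apply]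
  exact Prod.ext (LinearMap.congr_fun hpi x.1) (LinearMap.congr_fun hqj x.2)

end

variable {Λ E M : Type u} [Ring Λ] [Ring E] [AddCommGroup M] [Module Λ M] [Module E M]

variable (Λ E M) in
/-- The ring `E` acts on `M` as the full endomorphism ring. -/
def ActsAsEnd : Prop := ∀ φ : M →ₗ[Λ] M, ∃! e : E, ∀ x, e • x = φ x

variable [SMulCommClass Λ E M]
variable {X Y Z : Type u} [AddCommGroup X] [Module Λ X] [AddCommGroup Y] [Module Λ Y]
  [AddCommGroup Z] [Module Λ Z]

variable (E M) in
/-- Precomposition with a linear map. -/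
def precomp (f : X →ₗ[Λ] Y) : (Y →ₗ[Λ] M) →ₗ[E] (X →ₗ[Λ] M) where
  toFun u := u.comp f
  map_add' _ _ := rfl
  map_smul' _ _ := rfl

@[simp] theorem precomp_apply (f : X →ₗ[Λ] Y) (u : Y →ₗ[Λ] M) : precomp E M f u = u.comp f := rfl

theorem precomp_injective {f : X →ₗ[Λ] Y} (hf : Function.Surjective f) :
    Function.Injective (precomp E M f) := fun u v h ↦ LinearMap.ext fun y ↦ by
  obtain ⟨x, rfl⟩ := hf y
  exact LinearMap.congr_fun h x

theorem precomp_exact {f : X →ₗ[Λ] Y} {g : Y →ₗ[Λ] Z} (hfg : Function.Exact f g)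
    (hg : Function.Surjective g) : Function.Exact (precomp E M g) (precomp E M f) := by
  intro u
  constructor
  · intro hu
    have hle : LinearMap.ker g ≤ LinearMap.ker u := fun y hy ↦ by
      obtain ⟨x, rfl⟩ := (hfg y).1 hy
      exact LinearMap.congr_fun hu x
    refine ⟨((LinearMap.ker g).liftQ u hle).comp (g.quotKerEquivOfSurjective hg).symm.toLinearMap,
      LinearMap.ext fun y ↦ ?_⟩
    have : (g.quotKerEquivOfSurjective hg).symm (g y) = Submodule.Quotient.mk y := by
      rw [LinearEquiv.symm_apply_eq]; rfl
    simp [this]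
  · rintro ⟨v, rfl⟩
    refine LinearMap.ext fun x ↦ ?_
    change v (g (f x)) = 0
    rw [(hfg (f x)).2 ⟨x, rfl⟩, map_zero]

/-- The dual of a cokernel is the kernel of the dual map. -/
noncomputable def precompKerEquiv {f : X →ₗ[Λ] Y} {g : Y →ₗ[Λ] Z} (hfg : Function.Exact f g)
    (hg : Function.Surjective g) : (Z →ₗ[Λ] M) ≃ₗ[E] LinearMap.ker (precomp E M f) :=
  (LinearEquiv.ofInjective _ (precomp_injective hg)).trans
    (LinearEquiv.ofEq _ _ (LinearMap.exact_iff.1 (precomp_exact hfg hg)).symm)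

namespace ActsAsEnd

variable (hE : ActsAsEnd Λ E M)
include hE

theorem eq_of_smul_eq {a b : E} (h : ∀ x : M, a • x = b • x) : a = b :=
  (hE (b • LinearMap.id)).unique (fun x ↦ by simp [h]) fun x ↦ by simp

theorem nonempty_equiv_pi (n : ℕ) : Nonempty ((Fin n → E) ≃ₗ[E] ((Fin n → M) →ₗ[Λ] M)) := by
  let φ : E →ₗ[E] (M →ₗ[Λ] M) := LinearMap.toSpanSingleton E _ LinearMap.id
  have hφ : Function.Bijective φ := by
    refine ⟨fun a b h ↦ hE.eq_of_smul_eq fun x ↦ ?_, fun f ↦ ?_⟩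
    · simpa [φ] using LinearMap.congr_fun h x
    · obtain ⟨e, he, -⟩ := hE f
      exact ⟨e, LinearMap.ext fun x ↦ by simp [φ, he]⟩
  exact ⟨(LinearEquiv.piCongrRight fun _ ↦ LinearEquiv.ofBijective φ hφ).trans
    (LinearMap.lsum Λ (fun _ : Fin n ↦ M) E)⟩

theorem projective (hX : InAdd Λ M X) : Module.Projective E (X →ₗ[Λ] M) := by
  obtain ⟨n, i, p, hpi⟩ := hX
  obtain ⟨e⟩ := hE.nonempty_equiv_pi n
  have := Module.Projective.of_equiv e
  refine Module.Projective.of_split (precomp E M p) (precomp E M i) (LinearMap.ext fun u ↦ ?_)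
  simp [LinearMap.comp_assoc, hpi]

theorem finite (hX : InAdd Λ M X) : Module.Finite E (X →ₗ[Λ] M) := by
  obtain ⟨n, i, p, hpi⟩ := hX
  obtain ⟨e⟩ := hE.nonempty_equiv_pi n
  have := Module.Finite.equiv e
  refine Module.Finite.of_surjective (precomp E M i) fun u ↦ ⟨u.comp p, ?_⟩
  simp [LinearMap.comp_assoc, hpi]

theorem exists_eq_precomp (hX : InAdd Λ M X) (ρ : (X →ₗ[Λ] M) →ₗ[E] (Y →ₗ[Λ] M)) :
    ∃ σ : Y →ₗ[Λ] X, ρ = precomp E M σ := by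
  obtain ⟨n, i, p, hpi⟩ := hX
  let σ : Y →ₗ[Λ] (Fin n → M) := LinearMap.pi fun j ↦ ρ ((LinearMap.proj j).comp i)
  have hσ : ∀ u : (Fin n → M) →ₗ[Λ] M, ρ (u.comp i) = u.comp σ := by
    intro u
    choose a ha ha' using fun j ↦ hE (u.comp (LinearMap.single Λ (fun _ ↦ M) j))
    have hu : u = ∑ j, a j • LinearMap.proj (R := Λ) (φ := fun _ : Fin n ↦ M) j := by
      refine LinearMap.pi_ext' fun j ↦ LinearMap.ext fun x ↦ ?_
      have := ha j x
      rw [← this]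
      simp [Pi.single_apply]
    have h1 : u.comp i = ∑ j, a j • (LinearMap.proj j).comp i := by
      conv_lhs => rw [hu]
      ext x
      simp
    rw [h1, map_sum]
    conv_rhs => rw [hu]
    ext x
    simp [σ]
  refine ⟨p.comp σ, LinearMap.ext fun u ↦ ?_⟩
  have := hσ (u.comp p)
  rwa [LinearMap.comp_assoc, hpi, LinearMap.comp_id, LinearMap.comp_assoc] at this

/-- If the dual of `f` has projective image, the cokernel map of `f` splits. -/
theorem exists_section (hY : InAdd Λ M Y) {f : X →ₗ[Λ] Y} {g : Y →ₗ[Λ] Z}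
    (hfg : Function.Exact f g) (hg : Function.Surjective g)
    (hZ : ∀ z : Z, z ≠ 0 → ∃ h : Z →ₗ[Λ] M, h z ≠ 0)
    [Module.Projective E (LinearMap.range (precomp E M f))] :
    ∃ s : Z →ₗ[Λ] Y, ∀ z, g (s z) = z := by
  obtain ⟨t, ht⟩ := Module.projective_lifting_property (precomp E M f).rangeRestrict LinearMap.id
    (precomp E M f).surjective_rangeRestrict
  let q : (Y →ₗ[Λ] M) →ₗ[E] LinearMap.ker (precomp E M f) :=
    (LinearMap.id - t.comp (precomp E M f).rangeRestrict).codRestrict _ fun u ↦ by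
      have := congrArg Subtype.val (LinearMap.congr_fun ht ((precomp E M f).rangeRestrict u))
      rw [LinearMap.mem_ker, LinearMap.sub_apply, map_sub, sub_eq_zero]
      exact this.symm
  obtain ⟨s, hs⟩ := hE.exists_eq_precomp hY ((precompKerEquiv hfg hg).symm.toLinearMap.comp q)
  have key : ∀ h : Z →ₗ[Λ] M, h.comp (g.comp s) = h := by
    intro h
    have h1 := LinearMap.congr_fun hs (h.comp g)
    have h2 : q (h.comp g) = precompKerEquiv hfg hg h := by
      have h0 : (precomp E M f).rangeRestrict (h.comp g) = 0 :=
        Subtype.ext ((precomp_exact hfg hg _).2 ⟨h, rfl⟩)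
      refine Subtype.ext ?_
      change h.comp g - t ((precomp E M f).rangeRestrict (h.comp g)) = h.comp g
      rw [h0, map_zero, sub_zero]
    rw [LinearMap.comp_apply, h2, LinearEquiv.coe_coe, LinearEquiv.symm_apply_apply] at h1
    exact h1.symm
  refine ⟨s, fun z ↦ ?_⟩
  by_contra hz
  obtain ⟨h, hh⟩ := hZ _ (sub_ne_zero.2 hz)
  apply hh
  rw [map_sub, sub_eq_zero]
  exact LinearMap.congr_fun (key h) z

/-- The modules `Hom(C, M)` are the second syzygies over the endomorphism ring of `M`. -/
theorem globalDimLE [IsNoetherianRing E] [Module.Finite Λ M] {m : ℕ}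
    (h : ∀ (C : Type u) [AddCommGroup C] [Module Λ C], Module.Finite Λ C →
      PdLE E (C →ₗ[Λ] M) m) : GlobalDimLE E (m + 2) := by
  intro Y hY
  obtain ⟨n, s, hs⟩ := Module.Finite.exists_fin' E Y
  obtain ⟨r, t, ht⟩ := Module.Finite.exists_fin' E (LinearMap.ker s)
  obtain ⟨en⟩ := hE.nonempty_equiv_pi n
  obtain ⟨er⟩ := hE.nonempty_equiv_pi r
  have pn := hE.projective ((InAdd.refl M).pi n)
  have pr := hE.projective ((InAdd.refl M).pi r)
  obtain ⟨σ, hσ⟩ := hE.exists_eq_precomp ((InAdd.refl M).pi r)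
    (en.toLinearMap.comp (((LinearMap.ker s).subtype.comp t).comp er.symm.toLinearMap))
  have h1 := (h ((Fin r → M) ⧸ LinearMap.range σ) inferInstance).congr
    (precompKerEquiv (E := E) (M := M) (LinearMap.exact_map_mkQ_range σ)
      (Submodule.mkQ_surjective _))
  have h2 := PdLE.quotient_range_of_ker h1
  let s' : ((Fin n → M) →ₗ[Λ] M) →ₗ[E] Y := s.comp en.symm.toLinearMap
  have hs' : Function.Surjective s' := hs.comp en.symm.surjective
  have hker : LinearMap.range (precomp E M σ) = LinearMap.ker s' := by
    rw [← hσ]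
    ext u
    constructor
    · rintro ⟨v, rfl⟩
      simp [s']
    · intro hu
      obtain ⟨w, hw⟩ := ht ⟨en.symm u, hu⟩
      exact ⟨er w, by simp [hw]⟩
  rw [hker] at h2
  exact (h2.congr (s'.quotKerEquivOfSurjective hs')).projDimLE

end ActsAsEnd

end EndomorphismRing

section AnnihilatedModules

variable {Λ : Type u} [Ring Λ]

/-- The two-sided ideal `I` annihilates the module `X`. -/
def TwoSidedIdeal.Kills (I : TwoSidedIdeal Λ) (X : Type u) [AddCommGroup X] [Module Λ X] : Prop :=
  ∀ a ∈ I, ∀ x : X, a • x = 0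

namespace TwoSidedIdeal.Kills

variable {I : TwoSidedIdeal Λ} {X Y : Type u} [AddCommGroup X] [Module Λ X] [AddCommGroup Y]
  [Module Λ Y]

theorem of_injective (h : I.Kills Y) (f : X →ₗ[Λ] Y) (hf : Function.Injective f) : I.Kills X :=
  fun a ha x ↦ hf (by rw [map_smul, h a ha, map_zero])

theorem of_surjective (h : I.Kills X) (f : X →ₗ[Λ] Y) (hf : Function.Surjective f) : I.Kills Y :=
  fun a ha y ↦ by
    obtain ⟨x, rfl⟩ := hf y
    rw [← map_smul, h a ha, map_zero]

theorem pi (h : I.Kills X) (n : ℕ) : I.Kills (Fin n → X) :=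
  fun a ha x ↦ funext fun i ↦ h a ha (x i)

end TwoSidedIdeal.Kills

/-- Every finitely generated module killed by `I` is a quotient of one in `add M`. -/
def TwoSidedIdeal.Generates (I : TwoSidedIdeal Λ) (M : Type u) [AddCommGroup M] [Module Λ M] :
    Prop :=
  ∀ (X : Type u) [AddCommGroup X] [Module Λ X], Module.Finite Λ X → I.Kills X →
    ∃ (F : ModuleCat.{u} Λ) (π : F →ₗ[Λ] X), Module.Finite Λ F ∧ InAdd Λ M F ∧
      Function.Surjective π

/-- Modules killed by `I` are separated by maps to `M`. -/
def TwoSidedIdeal.Cogenerates (I : TwoSidedIdeal Λ) (M : Type u) [AddCommGroup M] [Module Λ M] :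
    Prop :=
  ∀ (X : Type u) [AddCommGroup X] [Module Λ X], I.Kills X → ∀ x : X, x ≠ 0 →
    ∃ h : X →ₗ[Λ] M, h x ≠ 0

variable {I : TwoSidedIdeal Λ}
  {E M : Type u} [Ring E] [AddCommGroup M] [Module Λ M] [Module E M] [SMulCommClass Λ E M]

namespace ActsAsEnd

variable (hE : ActsAsEnd Λ E M) (hM : I.Kills M) (hgen : I.Generates M)
include hE hM hgen

theorem exists_copresentation [IsNoetherianRing Λ] {F X : Type u} [AddCommGroup F]
    [Module Λ F] [AddCommGroup X] [Module Λ X] [Module.Finite Λ F] (hF : InAdd Λ M F)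
    (π : F →ₗ[Λ] X) :
    ∃ (F₁ : ModuleCat.{u} Λ) (f : F₁ →ₗ[Λ] F), Function.Exact f π ∧
      Module.Projective E (F₁ →ₗ[Λ] M) ∧ Module.Finite E (F₁ →ₗ[Λ] M) := by
  have hFI : I.Kills F := by
    obtain ⟨n, i, p, hpi⟩ := hF
    exact (hM.pi n).of_injective i (Function.LeftInverse.injective (LinearMap.congr_fun hpi))
  obtain ⟨F₁, g, hf, ha, hg⟩ := hgen (LinearMap.ker π) inferInstance
    (hFI.of_injective _ (Submodule.subtype_injective _))
  refine ⟨F₁, (LinearMap.ker π).subtype.comp g, ?_, hE.projective ha, hE.finite ha⟩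
  rw [LinearMap.exact_iff, LinearMap.range_comp, LinearMap.range_eq_top.2 hg]
  simp

theorem pdLE_hom [IsNoetherianRing Λ] {m : ℕ} (hd : GlobalDimLE E (m + 2)) (X : Type u)
    [AddCommGroup X] [Module Λ X] [hX : Module.Finite Λ X] (hIX : I.Kills X) :
    PdLE E (X →ₗ[Λ] M) m := by
  obtain ⟨F, π, hF, hFa, hπ⟩ := hgen X hX hIX
  obtain ⟨F₁, f, hf, h1, h2⟩ := hE.exists_copresentation hM hgen hFa π
  have := hE.projective hFa
  have h3 := (hd (ModuleCat.of E ((F₁ →ₗ[Λ] M) ⧸ LinearMap.range (precomp E M f)))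
    (inferInstanceAs (Module.Finite E ((F₁ →ₗ[Λ] M) ⧸ LinearMap.range (precomp E M f))))).pdLE
  exact (PdLE.ker_of_quotient_range h3).congr (precompKerEquiv hf hπ).symm

theorem exists_section_of_globalDimLE_one [IsNoetherianRing Λ] (hcog : I.Cogenerates M) {d : ℕ}
    (hd : GlobalDimLE E d) (hd1 : d ≤ 1) {F X : Type u} [AddCommGroup F] [Module Λ F]
    [AddCommGroup X] [Module Λ X] [Module.Finite Λ F] (hF : InAdd Λ M F) (hIX : I.Kills X) (π : F →ₗ[Λ] X)
    (hπ : Function.Surjective π) : ∃ s : X →ₗ[Λ] F, ∀ x, π (s x) = x := by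
  obtain ⟨F₁, f, hf, h1, h2⟩ := hE.exists_copresentation hM hgen hF π
  have h3 := (hd (ModuleCat.of E ((F₁ →ₗ[Λ] M) ⧸ LinearMap.range (precomp E M f)))
    (inferInstanceAs (Module.Finite E ((F₁ →ₗ[Λ] M) ⧸ LinearMap.range (precomp E M f))))).pdLE
  have := PdLE.zero_iff.1 (PdLE.range_of_quotient (h3.mono hd1))
  exact hE.exists_section hF hf hπ (hcog X hIX)

/-- Projective dimension does not grow when passing from `M` to a larger module `N` that
has the same `M`-approximations. -/
theorem pdLE_hom_of_inAdd [IsNoetherianRing E] [Module.Finite Λ M] (hcog : I.Cogenerates M)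
    {S N : Type u} [Ring S] [AddCommGroup N] [Module Λ N] [Module S N] [SMulCommClass Λ S N]
    (hS : ActsAsEnd Λ S N) (hMN : InAdd Λ N M)
    (hext : ∀ (X Y : Type u) [AddCommGroup X] [Module Λ X] [AddCommGroup Y] [Module Λ Y],
      I.Kills X → ∀ g : X →ₗ[Λ] Y, Function.Surjective (precomp E M g) →
        Function.Surjective (precomp S N g))
    (n : ℕ) (X : Type u) [AddCommGroup X] [Module Λ X] [hX : Module.Finite Λ X]
    (hIX : I.Kills X) (h : PdLE E (X →ₗ[Λ] M) n) : PdLE S (X →ₗ[Λ] N) n := by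
  induction n generalizing X with
  | zero | succ n ih => ?_
  all_goals
    obtain ⟨F, p, hF, hFa, hp⟩ := hgen X hX hIX
    have := hE.finite hFa
    have hfin : Module.Finite E (X →ₗ[Λ] M) :=
      Module.Finite.of_injective (precomp E M p) (precomp_injective hp)
    obtain ⟨r, b, hb⟩ := Module.Finite.exists_fin (R := E) (M := X →ₗ[Λ] M)
    let g : X →ₗ[Λ] (Fin r → M) := LinearMap.pi b
    have hgs : Function.Surjective (precomp E M g) := by
      rw [← LinearMap.range_eq_top, eq_top_iff, ← hb, Submodule.span_le]
      rintro _ ⟨j, rfl⟩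
      exact ⟨LinearMap.proj j, rfl⟩
    have hgi : Function.Injective g := by
      rw [injective_iff_map_eq_zero]
      intro x hx
      by_contra hx0
      obtain ⟨h, hh⟩ := hcog X hIX x hx0
      obtain ⟨w, hw⟩ := hgs h
      apply hh
      rw [← hw, precomp_apply, LinearMap.comp_apply, hx, map_zero]
    let C := (Fin r → M) ⧸ LinearMap.range g
    let π : (Fin r → M) →ₗ[Λ] C := Submodule.mkQ _
    have hπ : Function.Surjective π := Submodule.mkQ_surjective _
    have hgπ : Function.Exact g π := LinearMap.exact_map_mkQ_range g
    have hIC : I.Kills C := (hM.pi r).of_surjective π hπ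
    have hMr : InAdd Λ M (Fin r → M) := (InAdd.refl M).pi r
  · have hproj := PdLE.zero_iff.1 h
    have : Module.Projective E (LinearMap.range (precomp E M g)) := by
      rw [LinearMap.range_eq_top.2 hgs]
      exact Module.Projective.of_equiv Submodule.topEquiv.symm
    obtain ⟨s, hs⟩ := hE.exists_section hMr hgπ hπ (hcog C hIC)
    have hk : ∀ y, y - s (π y) ∈ LinearMap.range g := fun y ↦ (hgπ _).1 (by simp [hs])
    let t : (Fin r → M) →ₗ[Λ] X := (LinearEquiv.ofInjective g hgi).symm.toLinearMap.comp
      ((LinearMap.id - s.comp π).codRestrict _ hk)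
    have hX : InAdd Λ M X := hMr.of_retract g t fun x ↦ by
      rw [LinearMap.comp_apply, LinearEquiv.coe_coe, LinearEquiv.symm_apply_eq]
      refine Subtype.ext ?_
      change g x - s (π (g x)) = g x
      rw [(hgπ (g x)).2 ⟨x, rfl⟩, map_zero, sub_zero]
    exact PdLE.zero_iff.2 (hS.projective (hMN.trans hX))
  · have := hE.projective hMr
    have := hS.projective (hMN.pi r)
    have h1 : PdLE E (C →ₗ[Λ] M) n :=
      PdLE.left (precomp_injective hπ) (precomp_exact hgπ hπ) hgs h
    exact PdLE.right (precomp_injective hπ) (precomp_exact hgπ hπ) (hext _ _ hIX g hgs)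
      (ih C hIC h1)

end ActsAsEnd

end AnnihilatedModules

section Quotient

namespace TwoSidedIdeal

variable {Λ : Type u} [Ring Λ] (I : TwoSidedIdeal Λ)

/-- A module over the quotient ring whose restriction is the given `Λ`-module. -/
def Compatible (X : Type u) [AddCommGroup X] [Module Λ X] [Module I.ringCon.Quotient X] : Prop :=
  ∀ (a : Λ) (x : X), I.ringCon.mk' a • x = a • x

theorem mk'_surjective : Function.Surjective I.ringCon.mk' := Quotient.mk_surjective

variable {I} {X Y M : Type u} [AddCommGroup X] [AddCommGroup Y] [AddCommGroup M]

theorem mk'_eq_zero {a : Λ} (ha : a ∈ I) : I.ringCon.mk' a = 0 :=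
  (I.ringCon.eq).2 ha

/-- The module over the quotient ring on a module killed by `I`. -/
abbrev Kills.module [Module Λ X] (h : I.Kills X) : Module I.ringCon.Quotient X :=
  Module.compHom X (I.ringCon.lift (Module.toAddMonoidEnd Λ X) fun a b hab ↦ by
    have : a - b ∈ I := (TwoSidedIdeal.rel_iff I a b).1 hab
    ext x
    have := h _ this x
    rwa [sub_smul, sub_eq_zero] at this)

theorem Kills.compatible [Module Λ X] (h : I.Kills X) :
    letI := h.module; I.Compatible X := fun _ _ ↦ rfl

namespace Compatible

variable [Module Λ X] [Module I.ringCon.Quotient X] [Module Λ Y] [Module I.ringCon.Quotient Y]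
  [Module Λ M] [Module I.ringCon.Quotient M]

theorem kills (hX : I.Compatible X) : I.Kills X := fun a ha x ↦ by
  rw [← hX, mk'_eq_zero ha, zero_smul]

/-- Restriction of scalars for linear maps. -/
def restrict (hX : I.Compatible X) (hY : I.Compatible Y) (f : X →ₗ[I.ringCon.Quotient] Y) :
    X →ₗ[Λ] Y where
  toFun := f
  map_add' := f.map_add
  map_smul' a x := by rw [← hX, map_smul, hY, RingHom.id_apply]

/-- Linear maps over `Λ` are linear over the quotient ring. -/
def extend (hX : I.Compatible X) (hY : I.Compatible Y) (f : X →ₗ[Λ] Y) :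
    X →ₗ[I.ringCon.Quotient] Y where
  toFun := f
  map_add' := f.map_add
  map_smul' a x := by
    obtain ⟨a, rfl⟩ := I.mk'_surjective a
    rw [hX, map_smul, RingHom.id_apply, hY]

@[simp] theorem extend_apply (hX : I.Compatible X) (hY : I.Compatible Y) (f : X →ₗ[Λ] Y) (x : X) :
    hX.extend hY f x = f x := rfl

theorem pi (hX : I.Compatible X) (n : ℕ) : I.Compatible (Fin n → X) :=
  fun a x ↦ funext fun i ↦ hX a (x i)

theorem inAdd (hM : I.Compatible M) (hX : I.Compatible X) (h : InAdd I.ringCon.Quotient M X) :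
    InAdd Λ M X := by
  obtain ⟨n, i, p, hpi⟩ := h
  exact ⟨n, hX.restrict (hM.pi n) i, (hM.pi n).restrict hX p,
    LinearMap.ext fun x ↦ LinearMap.congr_fun hpi x⟩

theorem finite_quotient (hX : I.Compatible X) [Module.Finite Λ X] :
    Module.Finite I.ringCon.Quotient X := by
  have : RingHomSurjective I.ringCon.mk' := ⟨I.mk'_surjective⟩
  let f : X →ₛₗ[I.ringCon.mk'] X :=
    { toFun := id, map_add' := fun _ _ ↦ rfl, map_smul' := fun a x ↦ (hX a x).symm }
  exact Module.Finite.of_surjective f Function.surjective_id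

theorem finite (hX : I.Compatible X) [Module.Finite I.ringCon.Quotient X] :
    Module.Finite Λ X := by
  obtain ⟨n, s, hs⟩ := Module.Finite.exists_fin (R := I.ringCon.Quotient) (M := X)
  let T : Submodule I.ringCon.Quotient X :=
    { Submodule.span Λ (Set.range s) with
      smul_mem' := fun a x hx ↦ by
        obtain ⟨a, rfl⟩ := I.mk'_surjective a
        rw [hX]
        exact Submodule.smul_mem _ a hx }
  have hT : Submodule.span I.ringCon.Quotient (Set.range s) ≤ T :=
    Submodule.span_le.2 fun x hx ↦ Submodule.subset_span (R := Λ) hx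
  rw [hs] at hT
  exact ⟨⟨Set.finite_range s |>.toFinset, by
    rw [Set.Finite.coe_toFinset]
    exact eq_top_iff.2 fun x _ ↦ hT (Submodule.mem_top (x := x))⟩⟩

theorem projective (hX : I.Compatible X) [Module.Projective Λ X] :
    Module.Projective I.ringCon.Quotient X := by
  refine Module.Projective.of_lifting_property'' fun f hf ↦ ?_
  let _ : Module Λ (X →₀ I.ringCon.Quotient) := Module.compHom _ I.ringCon.mk'
  have hF : I.Compatible (X →₀ I.ringCon.Quotient) := fun _ _ ↦ rfl
  obtain ⟨g, hg⟩ := Module.projective_lifting_property (hF.restrict hX f) LinearMap.id hf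
  exact ⟨hX.extend hF g, LinearMap.ext fun x ↦ LinearMap.congr_fun hg x⟩

theorem injective (hX : I.Compatible X) {Q : Type u} [AddCommGroup Q] [Module Λ Q]
    [Module.Injective Λ Q] (i : X →ₗ[Λ] Q) (hi : Function.Injective i)
    (hQ : ∀ q : Q, (∀ a ∈ I, a • q = 0) → ∃ x, i x = q) :
    Module.Injective I.ringCon.Quotient X where
  out A B _ _ _ _ f hf g := by
    let _ : Module Λ A := Module.compHom _ I.ringCon.mk'
    have hA : I.Compatible A := fun _ _ ↦ rfl
    let _ : Module Λ B := Module.compHom _ I.ringCon.mk'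
    have hB : I.Compatible B := fun _ _ ↦ rfl
    obtain ⟨h, hh⟩ := Module.Injective.out (hA.restrict hB f) hf (i.comp (hA.restrict hX g))
    have hmem : ∀ b, h b ∈ LinearMap.range i := fun b ↦
      hQ _ fun a ha ↦ by rw [← map_smul, hB.kills a ha, map_zero]
    refine ⟨hB.extend hX ((LinearEquiv.ofInjective i hi).symm.toLinearMap.comp
      (h.codRestrict _ hmem)), fun a ↦ ?_⟩
    rw [extend_apply, LinearMap.comp_apply, LinearEquiv.coe_coe, LinearEquiv.symm_apply_eq]
    exact Subtype.ext (hh a)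

theorem smulCommClass (hM : I.Compatible M) :
    SMulCommClass Λ (Module.End I.ringCon.Quotient M) M :=
  ⟨fun a e x ↦ by
    rw [Module.End.smul_def, Module.End.smul_def, ← hM, ← hM, map_smul]⟩

theorem actsAsEnd (hM : I.Compatible M) : ActsAsEnd Λ (Module.End I.ringCon.Quotient M) M :=
  fun φ ↦ ⟨hM.extend hM φ, fun _ ↦ rfl, fun _ he ↦ LinearMap.ext he⟩

end Compatible

theorem actsAsEnd_self [Module Λ M] : ActsAsEnd Λ (Module.End Λ M) M :=
  fun φ ↦ ⟨φ, fun _ ↦ rfl, fun _ he ↦ LinearMap.ext he⟩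

variable (I) in
/-- The largest submodule killed by `I`. -/
def killed (Q : Type u) [AddCommGroup Q] [Module Λ Q] : Submodule Λ Q where
  carrier := {q | ∀ a ∈ I, a • q = 0}
  zero_mem' := fun a _ ↦ smul_zero a
  add_mem' h h' a ha := by rw [smul_add, h a ha, h' a ha, add_zero]
  smul_mem' b q h a ha := by rw [smul_smul, h _ (I.mul_mem_right _ _ ha)]

theorem kills_killed (Q : Type u) [AddCommGroup Q] [Module Λ Q] : I.Kills (I.killed Q) :=
  fun a ha q ↦ Subtype.ext (q.2 a ha)

section GenCogen

variable [Module Λ M] [Module I.ringCon.Quotient M] (hc : I.Compatible M)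
  (hM : IsGenCogen I.ringCon.Quotient M)
include hc hM

theorem inAdd_of_projective [Module Λ X] [Module.Finite Λ X] [Module.Projective Λ X]
    (hX : I.Kills X) : InAdd Λ M X := by
  let _ := hX.module
  exact hc.inAdd hX.compatible
    (hM.2.1 (ModuleCat.of _ X) hX.compatible.finite_quotient hX.compatible.projective)

theorem inAdd_of_injective [Module Λ X] [Module.Finite Λ X] {Q : Type u} [AddCommGroup Q]
    [Module Λ Q] [Module.Injective Λ Q] (hX : I.Kills X) (i : X →ₗ[Λ] Q)
    (hi : Function.Injective i) (hQ : ∀ q : Q, (∀ a ∈ I, a • q = 0) → ∃ x, i x = q) :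
    InAdd Λ M X := by
  let _ := hX.module
  exact hc.inAdd hX.compatible
    (hM.2.2 (ModuleCat.of _ X) hX.compatible.finite_quotient (hX.compatible.injective i hi hQ))

theorem inAdd_killed [IsNoetherianRing Λ] (Q : Type u) [AddCommGroup Q] [Module Λ Q]
    [Module.Finite Λ Q] [Module.Injective Λ Q] : InAdd Λ M (I.killed Q) :=
  inAdd_of_injective hc hM (kills_killed Q) (Submodule.subtype _) (Submodule.subtype_injective _)
    fun q hq ↦ ⟨⟨q, hq⟩, rfl⟩

theorem generates : I.Generates M := by
  intro X _ _ hX hIX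
  let _ := hIX.module
  have := hIX.compatible.finite_quotient
  obtain ⟨n, π, hπ⟩ := Module.Finite.exists_fin' I.ringCon.Quotient X
  let _ : Module Λ (Fin n → I.ringCon.Quotient) := Module.compHom _ I.ringCon.mk'
  have hF : I.Compatible (Fin n → I.ringCon.Quotient) := fun _ _ ↦ rfl
  refine ⟨ModuleCat.of Λ (Fin n → I.ringCon.Quotient), hF.restrict hIX.compatible π, hF.finite,
    hc.inAdd hF ?_, hπ⟩
  exact hM.2.1 (ModuleCat.of _ (Fin n → I.ringCon.Quotient))
    (inferInstanceAs (Module.Finite _ (Fin n → I.ringCon.Quotient)))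
    (inferInstanceAs (Module.Projective _ (Fin n → I.ringCon.Quotient)))

theorem cogenerates (k : Type u) [CommRing k] [IsArtinianRing k] [Algebra k Λ]
    [Module.Finite k Λ] [IsNoetherianRing Λ] : I.Cogenerates M := by
  intro X _ _ hIX x hx
  obtain ⟨Q, h, hQ, hQi, hh⟩ := exists_finite_injective_map_ne_zero k (Λ := Λ) hx
  obtain ⟨n, i, p, hpi⟩ := inAdd_killed hc hM Q
  let h' : X →ₗ[Λ] I.killed Q := h.codRestrict _ fun y a ha ↦ by
    rw [← map_smul, hIX a ha, map_zero]
  by_contra! hzero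
  have h1 : i (h' x) = 0 := funext fun j ↦ hzero ((LinearMap.proj j).comp (i.comp h'))
  have h2 : h' x = 0 := by
    have := (LinearMap.congr_fun hpi (h' x)).symm
    rwa [LinearMap.comp_apply, h1, map_zero] at this
  exact hh (congrArg Subtype.val h2)

theorem precomp_prod_surjective [SMulCommClass Λ (Module.End I.ringCon.Quotient M) M]
    [IsNoetherianRing Λ] (P : Type u) [AddCommGroup P]
    [Module Λ P] [Module.Finite Λ P] [Module.Injective Λ P] [Module Λ X] [Module Λ Y]
    (hX : I.Kills X) (g : X →ₗ[Λ] Y)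
    (hg : Function.Surjective (precomp (Module.End I.ringCon.Quotient M) M g)) :
    Function.Surjective (precomp (Module.End Λ (M × P)) (M × P) g) := by
  intro u
  obtain ⟨v, hv⟩ := hg ((LinearMap.fst Λ M P).comp u)
  obtain ⟨n, i, p, hpi⟩ := inAdd_killed hc hM P
  let u' : X →ₗ[Λ] I.killed P := ((LinearMap.snd Λ M P).comp u).codRestrict _ fun y a ha ↦ by
    rw [← map_smul, hX a ha, map_zero]
  choose w hw using fun j ↦ hg ((LinearMap.proj j).comp (i.comp u'))
  refine ⟨v.prod ((Submodule.subtype _).comp (p.comp (LinearMap.pi w))),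
    LinearMap.ext fun x ↦ Prod.ext (LinearMap.congr_fun hv x) ?_⟩
  have h1 : LinearMap.pi w (g x) = i (u' x) := funext fun j ↦ LinearMap.congr_fun (hw j) x
  change ((p (LinearMap.pi w (g x)) : I.killed P) : P) = (u x).2
  rw [h1]
  exact congrArg Subtype.val (LinearMap.congr_fun hpi (u' x))

end GenCogen

end TwoSidedIdeal

end Quotient

section ProjectiveInjectiveReduction

theorem Module.End.isNoetherianRing_of_finite (k : Type u) [CommRing k] [IsNoetherianRing k]
    {R M : Type u} [Ring R] [Algebra k R] [Module.Finite k R] [AddCommGroup M] [Module R M]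
    [Module.Finite R M] : IsNoetherianRing (Module.End R M) := by
  let _ : Module k M := Module.compHom M (algebraMap k R)
  have : IsScalarTower k R M := ⟨fun r a x ↦ by rw [Algebra.smul_def, mul_smul]; rfl⟩
  have : SMulCommClass R k M := IsScalarTower.to_smulCommClass'
  have : Module.Finite k M := Module.Finite.trans R M
  have : IsNoetherian k (Module.End R M) :=
    isNoetherian_of_injective (LinearMap.restrictScalarsₗ k R M M k)
      (LinearMap.restrictScalars_injective k)
  exact isNoetherian_of_tower k this

namespace TwoSidedIdeal

variable {Λ : Type u} [Ring Λ] [IsArtinianRing Λ] {P : Type u} [AddCommGroup P] [Module Λ P]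
  [Module.Finite Λ P] [Module.Projective Λ P] [Module.Injective Λ P] (hP : Indec Λ P)
  {I : TwoSidedIdeal Λ} (hIP : ∃ a ∈ I, ∃ x : P, a • x ≠ 0)
  (hmin : ∀ I' : TwoSidedIdeal Λ, I' ≤ I → (∃ a ∈ I', ∃ x : P, a • x ≠ 0) → I' = I)

include hP hIP hmin

/-- Every finitely generated module is the direct sum of copies of `P` and of a module
killed by `I`. -/
theorem induction_of_kills (Q : ∀ (C : Type u) [AddCommGroup C] [Module Λ C], Prop)
    (hQ : ∀ (C : Type u) [AddCommGroup C] [Module Λ C], Module.Finite Λ C → I.Kills C → Q C)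
    (hstep : ∀ (C C' : Type u) [AddCommGroup C] [Module Λ C] [AddCommGroup C'] [Module Λ C'],
      (C ≃ₗ[Λ] P × C') → Q C' → Q C)
    (C : Type u) [AddCommGroup C] [Module Λ C] [Module.Finite Λ C] : Q C := by
  have := hP.1
  refine Module.Injective.induction_of_splitting (P := P) Q (fun C _ _ hC h ↦ hQ C hC ?_)
    (fun C C' _ _ _ _ _ _ ⟨e⟩ h ↦ hstep C C' e h) C
  exact fun a ha x ↦ smul_eq_zero_of_not_injective hP hIP hmin h ha x

variable {M : Type u} [AddCommGroup M] [Module Λ M] [Module I.ringCon.Quotient M]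
  (hc : I.Compatible M) (hM : IsGenCogen I.ringCon.Quotient M)
include hc hM

theorem isGenCogen_prod : IsGenCogen Λ (M × P) := by
  have hMP : InAdd Λ (M × P) M :=
    (InAdd.refl _).of_retract (LinearMap.inl Λ M P) (LinearMap.fst Λ M P) fun _ ↦ rfl
  have hPP : InAdd Λ (M × P) P :=
    (InAdd.refl _).of_retract (LinearMap.inr Λ M P) (LinearMap.snd Λ M P) fun _ ↦ rfl
  have := hM.1
  have := hc.finite
  refine ⟨inferInstance, fun C hC hCp ↦ ?_, fun C hC hCi ↦ ?_⟩
  · refine induction_of_kills hP hIP hmin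
      (fun C _ _ ↦ Module.Projective Λ C → InAdd Λ (M × P) C)
      (fun C _ _ hC hIC hCp ↦ hMP.trans (inAdd_of_projective hc hM hIC))
      (fun C C' _ _ _ _ e ih hCp ↦ ?_) C hCp
    have : Module.Projective Λ C' := Module.Projective.of_split
      (e.symm.toLinearMap.comp (LinearMap.inr Λ P C'))
      ((LinearMap.snd Λ P C').comp e.toLinearMap) (LinearMap.ext fun x ↦ by simp)
    exact (hPP.prod (ih this)).of_retract e.toLinearMap e.symm.toLinearMap e.symm_apply_apply
  · refine induction_of_kills hP hIP hmin
      (fun C _ _ ↦ Module.Injective Λ C → InAdd Λ (M × P) C)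
      (fun C _ _ hC hIC hCi ↦ hMP.trans (inAdd_of_injective hc hM hIC LinearMap.id
        Function.injective_id fun q _ ↦ ⟨q, rfl⟩))
      (fun C C' _ _ _ _ e ih hCi ↦ ?_) C hCi
    have : Module.Injective Λ C' := Module.Injective.of_retract
      (e.symm.toLinearMap.comp (LinearMap.inr Λ P C'))
      ((LinearMap.snd Λ P C').comp e.toLinearMap) fun x ↦ by simp
    exact (hPP.prod (ih this)).of_retract e.toLinearMap e.symm.toLinearMap e.symm_apply_apply

theorem pdLE_hom_prod (k : Type u) [CommRing k] [IsArtinianRing k] [Algebra k Λ]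
    [Module.Finite k Λ] [IsNoetherianRing (Module.End I.ringCon.Quotient M)] {m : ℕ}
    (hd : GlobalDimLE (Module.End I.ringCon.Quotient M) (m + 2))
    (C : Type u) [AddCommGroup C] [Module Λ C] [Module.Finite Λ C] :
    PdLE (Module.End Λ (M × P)) (C →ₗ[Λ] M × P) m := by
  have := hc.smulCommClass
  have := hM.1
  have := hc.finite
  have hE := hc.actsAsEnd
  have hS := actsAsEnd_self (Λ := Λ) (M := M × P)
  refine induction_of_kills hP hIP hmin
    (fun C _ _ ↦ PdLE (Module.End Λ (M × P)) (C →ₗ[Λ] M × P) m)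
    (fun C _ _ hC hIC ↦ ?_) (fun C C' _ _ _ _ e ih ↦ ?_) C
  · refine hE.pdLE_hom_of_inAdd hc.kills (generates hc hM) (cogenerates hc hM k) hS
      ((InAdd.refl _).of_retract (LinearMap.inl Λ M P) (LinearMap.fst Λ M P) fun _ ↦ rfl)
      (fun X Y _ _ _ _ hX g hg ↦ precomp_prod_surjective hc hM P hX g hg) m C hIC ?_
    exact hE.pdLE_hom hc.kills (generates hc hM) hd C hIC
  · have hPP : InAdd Λ (M × P) P :=
      (InAdd.refl _).of_retract (LinearMap.inr Λ M P) (LinearMap.snd Λ M P) fun _ ↦ rfl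
    have := hS.projective hPP
    let f : P →ₗ[Λ] C := e.symm.toLinearMap.comp (LinearMap.inl Λ P C')
    let r : C →ₗ[Λ] P := (LinearMap.fst Λ P C').comp e.toLinearMap
    let g : C →ₗ[Λ] C' := (LinearMap.snd Λ P C').comp e.toLinearMap
    have hg : Function.Surjective g :=
      (LinearMap.snd_surjective (R := Λ) (M := P) (M₂ := C')).comp e.surjective
    have hfg : Function.Exact f g := fun x ↦ by
      constructor
      · intro hx
        exact ⟨(e x).1, e.injective (Prod.ext (by simp [f])
          (by simpa [f] using (show (e x).2 = 0 from hx).symm))⟩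
      · rintro ⟨y, rfl⟩
        simp [f, g]
    refine PdLE.middle (precomp_injective hg) (precomp_exact hfg hg) (fun u ↦ ⟨u.comp r, ?_⟩)
      ih PdLE.of_projective
    ext <;> simp [f, r]

omit hP hIP hmin in
/-- If the endomorphism ring of a generator-cogenerator has global dimension at most one, then
the ring is semisimple. -/
theorem Compatible.isSemisimpleRing (k : Type u) [CommRing k] [IsArtinianRing k] [Algebra k Λ]
    [Module.Finite k Λ] {d : ℕ} (hd : GlobalDimLE (Module.End I.ringCon.Quotient M) d)
    (hd1 : d ≤ 1) : IsSemisimpleRing I.ringCon.Quotient := by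
  have := hc.smulCommClass
  let _ : Module Λ I.ringCon.Quotient := Module.compHom _ I.ringCon.mk'
  have hR : I.Compatible I.ringCon.Quotient := fun _ _ ↦ rfl
  have := hR.finite
  have hF : InAdd Λ M I.ringCon.Quotient := hc.inAdd hR
    (hM.2.1 (ModuleCat.of _ I.ringCon.Quotient) (Module.Finite.self _)
      (inferInstanceAs (Module.Projective _ I.ringCon.Quotient)))
  refine (isSemisimpleModule_iff _ _).2 ⟨fun K ↦ ?_⟩
  let _ : Module Λ (I.ringCon.Quotient ⧸ K) := Module.compHom _ I.ringCon.mk'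
  have hQ : I.Compatible (I.ringCon.Quotient ⧸ K) := fun _ _ ↦ rfl
  obtain ⟨s, hs⟩ := hc.actsAsEnd.exists_section_of_globalDimLE_one hc.kills (generates hc hM)
    (cogenerates hc hM k) hd hd1 hF hQ.kills (hR.restrict hQ K.mkQ) K.mkQ_surjective
  let f : Module.End I.ringCon.Quotient I.ringCon.Quotient :=
    LinearMap.id - (hQ.extend hR s).comp K.mkQ
  have hK : ∀ x, f x ∈ K := fun x ↦
    (Submodule.Quotient.mk_eq_zero K).1 (((K.mkQ.map_sub _ _).trans
      (congrArg (K.mkQ x - ·) (hs (K.mkQ x)))).trans (sub_self _))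
  refine ⟨_, LinearMap.isCompl_of_proj (f := f.codRestrict K hK) fun x ↦
    Subtype.ext ?_⟩
  change (x : I.ringCon.Quotient) - s (K.mkQ x) = x
  rw [show K.mkQ (x : I.ringCon.Quotient) = 0 from
    (Submodule.Quotient.mk_eq_zero K).2 x.2, map_zero, sub_zero]

end TwoSidedIdeal

end ProjectiveInjectiveReduction


/-- Let `P` be an indecomposable projective-injective module, `I` a minimal two-sided ideal
with `IP ≠ 0`, and `Λ' = Λ/I`.  Then every indecomposable module not isomorphic to `P` is
annihilated by `I`, and if `Λ'` is not semisimple then `repdim Λ ≤ repdim Λ'`. -/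
theorem stmt13 (k : Type u) [CommRing k] [IsArtinianRing k]
    (Λ : Type u) [Ring Λ] [Algebra k Λ] [Module.Finite k Λ]
    (P : ModuleCat.{u} Λ) (hPf : Module.Finite Λ P) (hPi : Indec Λ P)
    (hPproj : Module.Projective Λ P) (hPinj : Module.Injective Λ P)
    (I : TwoSidedIdeal Λ)
    (hIP : ∃ a ∈ I, ∃ x : ↥P, a • x ≠ 0)
    (hmin : ∀ I' : TwoSidedIdeal Λ, I' ≤ I → (∃ a ∈ I', ∃ x : ↥P, a • x ≠ 0) → I' = I) :
    (∀ N : ModuleCat.{u} Λ, Module.Finite Λ N → Indec Λ N →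
      IsEmpty (↥N ≃ₗ[Λ] ↥P) → ∀ a ∈ I, ∀ x : ↥N, a • x = 0) ∧
    (¬ IsSemisimpleRing I.ringCon.Quotient →
      ∀ d : ℕ, RepDimLE I.ringCon.Quotient d → RepDimLE Λ d) := by
  have : IsArtinianRing Λ := IsArtinianRing.of_finite k Λ
  refine ⟨fun N hN hNi hNP a ha x ↦ ?_, fun hss d ⟨M, hM, hd⟩ ↦ ?_⟩
  · refine TwoSidedIdeal.smul_eq_zero_of_not_injective hPi hIP hmin (fun f hf ↦ ?_) ha x
    exact not_nonempty_iff.2 hNP (hNi.nonempty_linearEquiv_of_injective hPi.1 f hf)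
  · let _ : Module Λ M := Module.compHom M I.ringCon.mk'
    have hc : I.Compatible M := fun _ _ ↦ rfl
    have := hM.1
    have := hc.finite
    have : Module.Finite k I.ringCon.Quotient :=
      Module.Finite.of_surjective (I.ringCon.mkₐ k).toLinearMap I.mk'_surjective
    have := Module.End.isNoetherianRing_of_finite k (R := I.ringCon.Quotient) (M := M)
    have := Module.End.isNoetherianRing_of_finite k (R := Λ) (M := M × P)
    rcases d with _ | _ | m
    · exact absurd (hc.isSemisimpleRing hM k hd zero_le_one) hss
    · exact absurd (hc.isSemisimpleRing hM k hd le_rfl) hss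
    · exact ⟨ModuleCat.of Λ (M × P), TwoSidedIdeal.isGenCogen_prod hPi hIP hmin hc hM,
        TwoSidedIdeal.actsAsEnd_self.globalDimLE fun C _ _ _ ↦
          TwoSidedIdeal.pdLE_hom_prod hPi hIP hmin hc hM k hd C⟩
end
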